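/- Let N ≥ 1, m > 1, q ∈ (0,1), σ > 0 and let u_0 ∈ L^∞(ℝ^N) be non-negative. Then every non-negative weak solution u of ∂_t u = Δ(u^m) − |x|^σ u^q with u(0) = u_0 enjoys instantaneous shrinking and localization of its support: for every τ > 0 there exists R(τ) > 0, depending on u_0 and τ but not on t, such that for a.e. t ≥ τ one has u(t,x) = 0 for a.e. x with |x| ≥ R(τ). -/

import Mathlib

open MeasureTheory Set

noncomputable section

/-- A non-negative weak solution of `∂ₜ u = Δ(uᵐ) − w(x) u^q` on `(0,∞)×ℝᴺ`
with initial condition `u₀`, in the sense of Definition 1.1 of the paper: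
`u` is a bounded non-negative measurable function, and there is a measurable
vector field `g` (the weak spatial gradient of `uᵐ`) which is locally square
integrable on `(0,T)×ℝᴺ`, satisfies the weak derivative identity against test
functions in `C_c^1((0,T)×ℝᴺ)`, and satisfies the weak formulation of the
equation against test functions in `C_c^1([0,T)×ℝᴺ)`. -/
def IsWeakSolution (N : ℕ) (m q : ℝ) (w : EuclideanSpace ℝ (Fin N) → ℝ)
    (u0 : EuclideanSpace ℝ (Fin N) → ℝ)
    (u : ℝ → EuclideanSpace ℝ (Fin N) → ℝ) : Prop :=
  Measurable (Function.uncurry u) ∧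
  (∀ t x, 0 ≤ u t x) ∧
  (∃ C : ℝ, ∀ t x, u t x ≤ C) ∧
  ∃ g : ℝ → EuclideanSpace ℝ (Fin N) → EuclideanSpace ℝ (Fin N),
    Measurable (Function.uncurry g) ∧
    ∀ T > (0:ℝ),
      (∀ K : Set (EuclideanSpace ℝ (Fin N)), IsCompact K →
        ∫⁻ s in Ioo (0:ℝ) T, ∫⁻ x in K, ENNReal.ofReal (‖g s x‖ ^ 2) < ⊤) ∧
      (∀ ζ : ℝ × EuclideanSpace ℝ (Fin N) → ℝ, ContDiff ℝ 1 ζ →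
        HasCompactSupport ζ → (∀ s x, s ∉ Ioo (0:ℝ) T → ζ (s, x) = 0) →
        ∀ i : Fin N,
          (∫ s in Ioo (0:ℝ) T, ∫ x,
              (u s x) ^ m * fderiv ℝ ζ (s, x) (0, EuclideanSpace.single i 1))
            = - ∫ s in Ioo (0:ℝ) T, ∫ x, g s x i * ζ (s, x)) ∧
      (∀ ζ : ℝ × EuclideanSpace ℝ (Fin N) → ℝ, ContDiff ℝ 1 ζ →
        HasCompactSupport ζ → (∀ s x, T ≤ s → ζ (s, x) = 0) →
        ∫ s in Ioo (0:ℝ) T, ∫ x,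
            ((u0 x - u s x) * fderiv ℝ ζ (s, x) (1, 0)
              + fderiv ℝ ζ (s, x) (0, g s x)
              + w x * (u s x) ^ q * ζ (s, x)) = 0)

/-- `u₀` is a non-negative function in `L^∞(ℝᴺ)`. -/
def IsBddNonneg (N : ℕ) (u0 : EuclideanSpace ℝ (Fin N) → ℝ) : Prop :=
  Measurable u0 ∧ (∀ x, 0 ≤ u0 x) ∧ ∃ C : ℝ, ∀ x, u0 x ≤ C

/-- The solution `u` vanishes in finite time. -/
def VanishesInFiniteTime (N : ℕ) (u : ℝ → EuclideanSpace ℝ (Fin N) → ℝ) : Prop :=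
  ∃ Te : ℝ, 0 < Te ∧ ∀ᵐ t : ℝ, Te ≤ t → ∀ᵐ x : EuclideanSpace ℝ (Fin N), u t x = 0

/-- The support of `u(t)` is contained in `B(0,R)` for a.e. `t > 0`. -/
def SupportLocalized (N : ℕ) (R : ℝ) (u : ℝ → EuclideanSpace ℝ (Fin N) → ℝ) : Prop :=
  ∀ᵐ t : ℝ, 0 < t → ∀ᵐ x : EuclideanSpace ℝ (Fin N), R ≤ ‖x‖ → u t x = 0



section part1
open Filter Topology
set_option linter.unusedSectionVars false


lemma hasDerivAt_pp (k : ℕ) (y : ℝ) :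
    HasDerivAt (fun y : ℝ => (max y 0) ^ (k + 2)) ((k + 2 : ℝ) * (max y 0) ^ (k + 1)) y := by
  rcases lt_trichotomy y 0 with h | h | h
  · have h1 : (fun y : ℝ => (max y 0) ^ (k + 2)) =ᶠ[𝓝 y] fun _ => 0 := by
      filter_upwards [Iio_mem_nhds h] with z hz
      rw [max_eq_right (le_of_lt hz)]; simp
    rw [max_eq_right h.le]
    simpa using (hasDerivAt_const y (0 : ℝ)).congr_of_eventuallyEq h1
  · subst h
    rw [hasDerivAt_iff_isLittleO]
    simp only [max_self, sub_zero]
    have h0 : (fun y : ℝ => y ^ (k + 2)) =o[𝓝 0] fun y => y := by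
      have := Asymptotics.isLittleO_pow_id (𝕜 := ℝ) (n := k + 2) (by omega)
      simpa using this
    refine Asymptotics.IsBigO.trans_isLittleO ?_ h0
    refine Asymptotics.IsBigO.of_bound 1 (Eventually.of_forall fun z => ?_)
    simp only [one_mul]
    have : |max z 0| ≤ |z| := by
      rcases le_total z 0 with h | h
      · rw [max_eq_right h]; simp
      · rw [max_eq_left h]
    have := pow_le_pow_left₀ (abs_nonneg _) this (k + 2)
    simpa [Real.norm_eq_abs, abs_pow] using this
  · have h1 : (fun y : ℝ => (max y 0) ^ (k + 2)) =ᶠ[𝓝 y] fun y => y ^ (k + 2) := by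
      filter_upwards [Ioi_mem_nhds h] with z hz
      rw [max_eq_left (le_of_lt hz)]
    rw [max_eq_left h.le]
    have := (hasDerivAt_pow (k + 2) y).congr_of_eventuallyEq h1
    simpa using this

lemma contDiff_pp (k : ℕ) : ContDiff ℝ 1 (fun y : ℝ => (max y 0) ^ (k + 2)) := by
  rw [contDiff_one_iff_deriv]
  refine ⟨fun y => (hasDerivAt_pp k y).differentiableAt, ?_⟩
  have : deriv (fun y : ℝ => (max y 0) ^ (k + 2))
      = fun y => (k + 2 : ℝ) * (max y 0) ^ (k + 1) := by
    ext y; exact (hasDerivAt_pp k y).deriv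
  rw [this]
  fun_prop

section moll
open ContinuousLinearMap
open scoped Convolution
variable {E : Type*} [NormedAddCommGroup E] [NormedSpace ℝ E] [FiniteDimensional ℝ E]
  [MeasureSpace E] [BorelSpace E] [(volume : Measure E).IsAddHaarMeasure]

/-- mollification -/
def moll (φ : ContDiffBump (0 : E)) (g : E → ℝ) : E → ℝ :=
  φ.normed volume ⋆[lsmul ℝ ℝ, volume] g

lemma moll_def (φ : ContDiffBump (0 : E)) (g : E → ℝ) (z : E) :
    moll φ g z = ∫ y, φ.normed volume y * g (z - y) := by
  simp [moll, convolution_def]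

lemma moll_eq (φ : ContDiffBump (0 : E)) (g : E → ℝ) (z : E) :
    moll φ g z = ∫ y, φ.normed volume (z - y) * g y := by
  simp [moll, convolution_eq_swap]

lemma moll_int (φ : ContDiffBump (0 : E)) {g : E → ℝ} (hg : LocallyIntegrable g volume) (z : E) :
    Integrable (fun y => φ.normed volume y * g (z - y)) := by
  have := (HasCompactSupport.convolutionExists_left (μ := volume) (lsmul ℝ ℝ)
    (φ.hasCompactSupport_normed (μ := volume)) φ.continuous_normed hg) z
  simpa [ConvolutionExistsAt] using this

lemma moll_contDiff (φ : ContDiffBump (0 : E)) {g : E → ℝ} (hg : LocallyIntegrable g volume) :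
    ContDiff ℝ 1 (moll φ g) := by
  exact_mod_cast HasCompactSupport.contDiff_convolution_left (n := 1) _ φ.hasCompactSupport_normed
    φ.contDiff_normed hg

lemma moll_fderiv (φ : ContDiffBump (0 : E)) {g : E → ℝ} (hg : LocallyIntegrable g volume)
    (z v : E) :
    fderiv ℝ (moll φ g) z v = ∫ y, fderiv ℝ (φ.normed volume) (z - y) v * g y := by
  have h1 := HasCompactSupport.hasFDerivAt_convolution_left (μ := volume) (lsmul ℝ ℝ)
    (φ.hasCompactSupport_normed (μ := volume)) φ.contDiff_normed hg z
  rw [show moll φ g = φ.normed volume ⋆[lsmul ℝ ℝ, volume] g from rfl, h1.fderiv]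
  have h2 := (HasCompactSupport.convolutionExists_left (μ := volume) ((lsmul ℝ ℝ).precompL E)
    ((φ.hasCompactSupport_normed (μ := volume)).fderiv ℝ)
    ((φ.contDiff_normed (n := 1)).continuous_fderiv one_ne_zero) hg) z
  rw [convolution_eq_swap, ContinuousLinearMap.integral_apply h2.integrable_swap]
  simp [precompL_apply]

lemma moll_le (φ : ContDiffBump (0 : E)) {g : E → ℝ} (hg : LocallyIntegrable g volume)
    {M : ℝ} (hM : ∀ y, g y ≤ M) (z : E) : moll φ g z ≤ M := by
  rw [moll_def]
  calc _ ≤ ∫ y, φ.normed volume y * M := by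
        refine integral_mono (moll_int φ hg z) (φ.integrable_normed.mul_const M) fun y => ?_
        exact mul_le_mul_of_nonneg_left (hM _) (φ.nonneg_normed y)
    _ = M := by rw [integral_mul_const, φ.integral_normed, one_mul]

lemma moll_nonneg (φ : ContDiffBump (0 : E)) {g : E → ℝ} (hM : ∀ y, 0 ≤ g y) (z : E) :
    0 ≤ moll φ g z := by
  rw [moll_def]
  exact integral_nonneg fun y => mul_nonneg (φ.nonneg_normed y) (hM _)

lemma moll_shift_sub (φ : ContDiffBump (0 : E)) {g : E → ℝ} (hg : LocallyIntegrable g volume)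
    (z e : E) : moll φ g (z - e) - moll φ g z = moll φ (fun y => g (y - e) - g y) z := by
  rw [moll_def, moll_def, moll_def, ← integral_sub (moll_int φ hg _) (moll_int φ hg _)]
  congr 1; ext y
  rw [mul_sub, sub_right_comm]

lemma memLp_two_sq {g : E → ℝ} (hg : MemLp g 2 volume) : Integrable (fun y => g y ^ 2) :=
  hg.integrable_sq

lemma memLp_two_loc {g : E → ℝ} (hg : MemLp g 2 volume) : LocallyIntegrable g volume :=
  hg.locallyIntegrable (by norm_num)

lemma moll_sq_le (φ : ContDiffBump (0 : E)) {g : E → ℝ} (hg : MemLp g 2 volume) (z : E) :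
    (moll φ g z) ^ 2 ≤ moll φ (fun y => g y ^ 2) z := by
  have i1 := moll_int φ (memLp_two_loc hg) z
  have i2 := moll_int φ (memLp_two_sq hg).locallyIntegrable z
  have i3 := φ.integrable_normed (μ := volume)
  set c := moll φ g z with hc
  have h0 : 0 ≤ ∫ y, φ.normed volume y * (g (z - y) - c) ^ 2 :=
    integral_nonneg fun y => mul_nonneg (φ.nonneg_normed y) (sq_nonneg _)
  have h1 : ∫ y, φ.normed volume y * (g (z - y) - c) ^ 2
      = moll φ (fun y => g y ^ 2) z - 2 * c * moll φ g z + c ^ 2 := by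
    have : (fun y => φ.normed volume y * (g (z - y) - c) ^ 2)
      = fun y => (φ.normed volume y * g (z - y) ^ 2 - (2 * c) * (φ.normed volume y * g (z - y)))
        + φ.normed volume y * c ^ 2 := by ext y; ring
    have i4 : Integrable (fun y => φ.normed volume y * g (z - y) ^ 2
        - (2 * c) * (φ.normed volume y * g (z - y))) := i2.sub (i1.const_mul _)
    rw [this, integral_add i4 (i3.mul_const _),
      integral_sub i2 (i1.const_mul _), integral_const_mul, integral_mul_const, φ.integral_normed,
      moll_def, moll_def, one_mul]
  rw [h1, ← hc] at h0
  nlinarith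

lemma moll_sq_int (φ : ContDiffBump (0 : E)) {g : E → ℝ} (hg : MemLp g 2 volume) :
    Integrable (fun z => (moll φ g z) ^ 2) ∧ ∫ z, (moll φ g z) ^ 2 ≤ ∫ z, g z ^ 2 := by
  have i2 := memLp_two_sq hg
  have i3 := φ.integrable_normed (μ := volume)
  have hi : Integrable (moll φ (fun y => g y ^ 2)) := i3.integrable_convolution _ i2
  have he : ∫ z, moll φ (fun y => g y ^ 2) z = ∫ z, g z ^ 2 := by
    have := integral_convolution (μ := volume) (ν := volume) (lsmul ℝ ℝ) i3 i2
    simpa [φ.integral_normed, moll] using this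
  have hI : Integrable (fun z => (moll φ g z) ^ 2) := by
    refine hi.mono' ((moll_contDiff φ (memLp_two_loc hg)).continuous.pow 2).aestronglyMeasurable
      (Eventually.of_forall fun z => ?_)
    rw [Real.norm_of_nonneg (sq_nonneg _)]
    exact moll_sq_le φ hg z
  exact ⟨hI, he ▸ integral_mono hI hi (moll_sq_le φ hg)⟩

lemma memLp_shift {g : E → ℝ} (hg : MemLp g 2 volume) (e : E) :
    MemLp (fun y => g (y - e)) 2 volume :=
  hg.comp_measurePreserving (measurePreserving_sub_right volume e)

lemma moll_shift_sq (φ : ContDiffBump (0 : E)) {g : E → ℝ} (hg : MemLp g 2 volume) (e : E) :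
    Integrable (fun z => (moll φ g (z - e) - moll φ g z) ^ 2) ∧
    ∫ z, (moll φ g (z - e) - moll φ g z) ^ 2 ≤ ∫ z, (g (z - e) - g z) ^ 2 := by
  simp_rw [moll_shift_sub φ (memLp_two_loc hg)]
  exact moll_sq_int φ ((memLp_shift hg e).sub hg)

lemma trans_cont {g : E → ℝ} (hg : MemLp g 2 volume) (e : E) {δ : ℝ} (hδ : 0 < δ) :
    ∃ h0 > (0 : ℝ), ∀ r : ℝ, |r| ≤ h0 → ∫ z, (g (z - r • e) - g z) ^ 2 ≤ δ := by
  have : Fact ((2 : ENNReal) ≠ ⊤) := ⟨by norm_num⟩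
  let F : ℝ → Lp ℝ 2 (volume : Measure E) :=
    fun r => (DomAddAct.mk (-(r • e)) : Eᵈᵃᵃ) +ᵥ hg.toLp g
  have hF : Continuous F := by
    have h1 : Continuous fun r : ℝ => (DomAddAct.mk (-(r • e)) : Eᵈᵃᵃ) := by
      exact DomAddAct.continuous_mk.comp (by fun_prop)
    exact h1.vadd continuous_const
  have hF0 : F 0 = hg.toLp g := by simp [F]
  have key : ∀ r, ‖F r - F 0‖ ^ 2 = ∫ z, (g (z - r • e) - g z) ^ 2 := by
    intro r
    rw [← real_inner_self_eq_norm_sq, L2.inner_def]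
    refine integral_congr_ae ?_
    have h1 : (F r : E → ℝ) =ᵐ[volume] fun z => g (z - r • e) := by
      have h2 : F r = (memLp_shift hg (r • e)).toLp _ := by
        simp only [F]
        rw [DomAddAct.mk_vadd_toLp]
        congr 1; ext y; simp [sub_eq_add_neg, add_comm]
      rw [h2]; exact MemLp.coeFn_toLp _
    have h3 : (F 0 : E → ℝ) =ᵐ[volume] g := by rw [hF0]; exact MemLp.coeFn_toLp _
    filter_upwards [h1, h3, Lp.coeFn_sub (F r) (F 0)] with z a b c
    rw [c, Pi.sub_apply, a, b]
    simp [sq]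
  have hc : Continuous fun r => ‖F r - F 0‖ ^ 2 := by fun_prop
  have := Metric.continuous_iff.1 hc 0 δ hδ
  obtain ⟨η, hη, h⟩ := this
  refine ⟨η / 2, by positivity, fun r hr => ?_⟩
  have := h r (by rw [Real.dist_eq, sub_zero]; linarith)
  rw [← key]
  simp only [sub_self, norm_zero, ne_eq, OfNat.ofNat_ne_zero, not_false_eq_true, zero_pow,
    Real.dist_eq, sub_zero] at this
  exact (le_abs_self _).trans this.le
end moll
end part1

section part2
open Filter Topology
set_option linter.unusedSectionVars false

section classical
variable {E : Type*} [NormedAddCommGroup E] [NormedSpace ℝ E] [FiniteDimensional ℝ E]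
  [MeasureSpace E] [BorelSpace E] [(volume : Measure E).IsAddHaarMeasure]

lemma int_of_compact {f : E → ℝ} (hf : Continuous f) {K : Set E} (hK : IsCompact K)
    (h : ∀ z, z ∉ K → f z = 0) : Integrable f volume :=
  hf.integrable_of_hasCompactSupport (HasCompactSupport.intro hK fun z hz => h z hz)

lemma shift_mvt {η v : E → ℝ} (hη : Continuous η) (hv : ContDiff ℝ 1 v) {K : Set E}
    (hK : IsCompact K) (hηK : ∀ z, z ∉ K → η z = 0) (e : E) {h : ℝ} (hh : 0 < h) :
    ∃ r ∈ Ioo 0 h, ∫ z, η z * (v z - v (z - h • e))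
      = h * ∫ z, η z * fderiv ℝ v (z - r • e) e := by
  have hvc := hv.continuous
  have hv' : Continuous (fderiv ℝ v) := hv.continuous_fderiv one_ne_zero
  let j : ℝ → ℝ := fun r => ∫ z, η z * v (z - r • e)
  have hi : ∀ r : ℝ, Integrable (fun z => η z * v (z - r • e)) := fun r =>
    int_of_compact (by fun_prop) hK fun z hz => by simp [hηK z hz]
  have hd : ∀ r : ℝ, HasDerivAt j (∫ z, η z * -(fderiv ℝ v (z - r • e) e)) r := by
    intro r
    obtain ⟨M, hM⟩ := (hK.prod (isCompact_Icc (a := r - 1) (b := r + 1))).exists_bound_of_continuousOn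
      (f := fun p : E × ℝ => η p.1 * -(fderiv ℝ v (p.1 - p.2 • e) e)) (by fun_prop)
    refine (hasDerivAt_integral_of_dominated_loc_of_deriv_le (s := Ioo (r - 1) (r + 1))
      (F := fun r z => η z * v (z - r • e))
      (F' := fun r z => η z * -(fderiv ℝ v (z - r • e) e))
      (bound := K.indicator fun _ => M) (Ioo_mem_nhds (by linarith) (by linarith)) 
      (Eventually.of_forall fun r => (hi r).aestronglyMeasurable) (hi r) ?_ ?_ ?_ ?_).2
    · exact Continuous.aestronglyMeasurable (by fun_prop)
    · refine Eventually.of_forall fun z s hs => ?_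
      by_cases hz : z ∈ K
      · rw [indicator_of_mem hz]
        exact hM (z, s) ⟨hz, hs.1.le, hs.2.le⟩
      · rw [indicator_of_notMem hz, hηK z hz]; simp
    · exact (integrable_indicator_iff hK.measurableSet).2
        (integrableOn_const hK.measure_lt_top.ne)
    · refine Eventually.of_forall fun z s hs => ?_
      have h1 : HasDerivAt (fun r : ℝ => z - r • e) (-e) s := by
        simpa using ((hasDerivAt_id s).smul_const e).const_sub z
      have h2 := ((hv.differentiable one_ne_zero (z - s • e)).hasFDerivAt).comp_hasDerivAt s h1
      have h3 := h2.const_mul (η z)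
      simpa using h3
  obtain ⟨r, hr, hr'⟩ := exists_hasDerivAt_eq_slope j _ hh
    (fun r _ => (hd r).continuousAt.continuousWithinAt) (fun r _ => hd r)
  refine ⟨r, hr, ?_⟩
  have e1 : ∫ z, η z * (v z - v (z - h • e)) = j 0 - j h := by
    simp only [j]
    rw [← integral_sub (hi 0) (hi h)]
    simp [mul_sub]
  rw [e1]
  simp only [mul_neg, integral_neg] at hr'
  rw [eq_div_iff (by linarith)] at hr'
  linarith

lemma classical_ineq {ι : Type*} [Fintype ι] (e : E) (d : ι → E) {v W F V Θ : E → ℝ}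
    {G p : ι → E → ℝ} (hv : ContDiff ℝ 1 v) (hW : ContDiff ℝ 1 W) (hF : Continuous F)
    (hV : ContDiff ℝ 1 V) (hΘ : ContDiff ℝ 1 Θ) (hG : ∀ i, ContDiff ℝ 1 (G i))
    (hp : ∀ i, ContDiff ℝ 1 (p i)) {K : Set E} (hK : IsCompact K) {h : ℝ} (hh : 0 < h)
    (hΘ0 : ∀ z, 0 ≤ Θ z) (hΘd : ∀ z i, fderiv ℝ Θ z (d i) = 0)
    (hWV : ∀ z, z ∉ K → Θ z * max (W z - V z) 0 = 0)
    (hWG : ∀ z ∈ K, ∀ i, fderiv ℝ W z (d i) = G i z)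
    (hVp : ∀ z i, fderiv ℝ V z (d i) = p i z)
    (hpde : ∀ z ∈ K, ∀ r ∈ Icc 0 h, fderiv ℝ v (z - r • e) e
      = ∑ i, fderiv ℝ (G i) (z - r • e) (d i) - F (z - r • e)) :
    ∃ r ∈ Ioo 0 h, ∫ z, Θ z * (max (W z - V z) 0) ^ 2 * (v z - v (z - h • e))
      ≤ h * ((∫ z, Θ z * (max (W z - V z) 0) ^ 2 * (∑ i, fderiv ℝ (p i) z (d i) - F z))
        + (∫ z, Θ z * (max (W z - V z) 0) ^ 2 * |F (z - r • e) - F z|)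
        + ∑ i, ∫ z, 2⁻¹ * (Θ z * max (W z - V z) 0) * (G i (z - r • e) - G i z) ^ 2) := by
  set η : E → ℝ := fun z => Θ z * (max (W z - V z) 0) ^ 2 with hηdef
  have hηC : ContDiff ℝ 1 η := hΘ.mul ((contDiff_pp 0).comp (hW.sub hV))
  have hηc := hηC.continuous
  have hη' : Continuous (fderiv ℝ η) := hηC.continuous_fderiv one_ne_zero
  have hηK : ∀ z, z ∉ K → η z = 0 := fun z hz => by
    have := hWV z hz
    simp only [hηdef, sq, ← mul_assoc, this, zero_mul]
  have hη0 : ∀ z, 0 ≤ η z := fun z => mul_nonneg (hΘ0 z) (sq_nonneg _)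
  have hη'K : ∀ z, z ∉ K → fderiv ℝ η z = 0 := fun z hz => by
    have : η =ᶠ[𝓝 z] fun _ => 0 := by
      filter_upwards [hK.isClosed.isOpen_compl.mem_nhds hz] with y hy using hηK y hy
    rw [this.fderiv_eq]; simp
  have hη'v : ∀ z i, fderiv ℝ η z (d i)
      = 2 * (Θ z * max (W z - V z) 0) * (G i z - p i z) := by
    intro z i
    by_cases hz : z ∈ K
    · have h1 : HasFDerivAt (fun z => W z - V z) (fderiv ℝ W z - fderiv ℝ V z) z :=
        ((hW.differentiable one_ne_zero z).hasFDerivAt).sub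
          ((hV.differentiable one_ne_zero z).hasFDerivAt)
      have h2 := (hasDerivAt_pp 0 (W z - V z)).comp_hasFDerivAt z h1
      have h3 := ((hΘ.differentiable one_ne_zero z).hasFDerivAt).mul h2
      have h4 : HasFDerivAt η _ z := h3
      rw [h4.fderiv]
      simp [hΘd, hWG z hz, hVp]
      ring
    · rw [hη'K z hz, hWV z hz]; simp
  have hGc := fun i => (hG i).continuous
  have hpc := fun i => (hp i).continuous
  have hG' : ∀ i, Continuous (fderiv ℝ (G i)) := fun i => (hG i).continuous_fderiv one_ne_zero
  have hp' : ∀ i, Continuous (fderiv ℝ (p i)) := fun i => (hp i).continuous_fderiv one_ne_zero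
  have hWc := hW.continuous
  have hVc := hV.continuous
  have hΘc := hΘ.continuous
  obtain ⟨r, hr, hreq⟩ := shift_mvt hηc hv hK hηK e hh
  refine ⟨r, hr, ?_⟩
  rw [hreq]
  refine mul_le_mul_of_nonneg_left ?_ hh.le
  have hrI : r ∈ Icc 0 h := ⟨hr.1.le, hr.2.le⟩
  have iG : ∀ i, Integrable (fun z => η z * fderiv ℝ (G i) (z - r • e) (d i)) := fun i =>
    int_of_compact (by fun_prop) hK fun z hz => by simp [hηK z hz]
  have ip : ∀ i, Integrable (fun z => η z * fderiv ℝ (p i) z (d i)) := fun i =>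
    int_of_compact (by fun_prop) hK fun z hz => by simp [hηK z hz]
  have iF : Integrable (fun z => η z * F z) :=
    int_of_compact (by fun_prop) hK fun z hz => by simp [hηK z hz]
  have iF1 : Integrable (fun z => η z * F (z - r • e)) :=
    int_of_compact (by fun_prop) hK fun z hz => by simp [hηK z hz]
  have iF2 : Integrable (fun z => η z * |F (z - r • e) - F z|) :=
    int_of_compact (by fun_prop) hK fun z hz => by simp [hηK z hz]
  have iQ : ∀ i, Integrable (fun z => 2⁻¹ * (Θ z * max (W z - V z) 0)
      * (G i (z - r • e) - G i z) ^ 2) := fun i =>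
    int_of_compact (by fun_prop) hK fun z hz => by simp only [hWV z hz]; simp
  have step : ∀ i, ∫ z, η z * fderiv ℝ (G i) (z - r • e) (d i)
      ≤ (∫ z, η z * fderiv ℝ (p i) z (d i)) + ∫ z, 2⁻¹ * (Θ z * max (W z - V z) 0)
      * (G i (z - r • e) - G i z) ^ 2 := by
    intro i
    have hGs : ContDiff ℝ 1 (fun z => G i (z - r • e)) := (hG i).comp (contDiff_id.sub contDiff_const)
    have j1 : Integrable (fun z => fderiv ℝ η z (d i) * G i (z - r • e)) :=
      int_of_compact (by fun_prop) hK fun z hz => by simp [hη'K z hz]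
    have j2 : Integrable (fun z => fderiv ℝ η z (d i) * p i z) :=
      int_of_compact (by fun_prop) hK fun z hz => by simp [hη'K z hz]
    have b1 := integral_mul_fderiv_eq_neg_fderiv_mul_of_integrable (μ := volume) (f := η)
      (g := fun z => G i (z - r • e)) (v := d i) j1
      (by simpa [fderiv_comp_sub] using iG i)
      (int_of_compact (by fun_prop) hK fun z hz => by simp [hηK z hz])
      (fun z _ => hηC.differentiable one_ne_zero z) (fun z _ => hGs.differentiable one_ne_zero z)
    have b2 := integral_mul_fderiv_eq_neg_fderiv_mul_of_integrable (μ := volume) (f := η)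
      (g := p i) (v := d i) j2 (ip i)
      (int_of_compact (by fun_prop) hK fun z hz => by simp [hηK z hz])
      (fun z _ => hηC.differentiable one_ne_zero z)
      (fun z _ => (hp i).differentiable one_ne_zero z)
    simp only [fderiv_comp_sub] at b1
    rw [b1, b2, ← sub_le_iff_le_add', sub_neg_eq_add, neg_add_eq_sub, ← integral_sub j2 j1]
    refine integral_mono (j2.sub j1) (iQ i) fun z => ?_
    simp only [hη'v]
    have hw : 0 ≤ Θ z * max (W z - V z) 0 := mul_nonneg (hΘ0 z) (le_max_right _ _)
    nlinarith [mul_nonneg hw (sq_nonneg ((G i z - p i z) + (G i (z - r • e) - p i z)))]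
  have eq1 : ∫ z, η z * fderiv ℝ v (z - r • e) e
      = (∑ i, ∫ z, η z * fderiv ℝ (G i) (z - r • e) (d i)) - ∫ z, η z * F (z - r • e) := by
    rw [← integral_finsetSum _ (fun i _ => iG i), ← integral_sub (integrable_finsetSum _ (fun i _ => iG i)) iF1]
    congr 1; ext z
    by_cases hz : z ∈ K
    · rw [hpde z hz r hrI, mul_sub, Finset.mul_sum]
    · simp [hηK z hz]
  have eq2 : ∫ z, η z * (∑ i, fderiv ℝ (p i) z (d i) - F z)
      = (∑ i, ∫ z, η z * fderiv ℝ (p i) z (d i)) - ∫ z, η z * F z := by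
    rw [← integral_finsetSum _ (fun i _ => ip i), ← integral_sub (integrable_finsetSum _ (fun i _ => ip i)) iF]
    congr 1; ext z
    rw [mul_sub, Finset.mul_sum]
  have eq3 : -∫ z, η z * F (z - r • e) ≤ -(∫ z, η z * F z) + ∫ z, η z * |F (z - r • e) - F z| := by
    have : ∫ z, η z * F z ≤ (∫ z, η z * F (z - r • e)) + ∫ z, η z * |F (z - r • e) - F z| := by
      rw [← integral_add iF1 iF2]
      refine integral_mono iF (iF1.add iF2) fun z => ?_
      have := neg_abs_le (F (z - r • e) - F z)
      simp only [← mul_add]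
      exact mul_le_mul_of_nonneg_left (by linarith) (hη0 z)
    linarith
  have s := Finset.sum_le_sum fun i (_ : i ∈ Finset.univ) => step i
  rw [Finset.sum_add_distrib] at s
  rw [eq1, eq2]
  linarith
end classical
end part2

section part3
open Filter Topology
set_option linter.unusedSectionVars false

section limit
variable {E : Type*} [NormedAddCommGroup E] [NormedSpace ℝ E] [FiniteDimensional ℝ E]
  [MeasureSpace E] [BorelSpace E] [(volume : Measure E).IsAddHaarMeasure]

/-- weak form of the system on an open set `Q`, test functions being supported in a compact subset -/
structure WeakSys {ι : Type*} [Fintype ι] (e : E) (d : ι → E) (Q : Set E) (u U f : E → ℝ)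
    (g : ι → E → ℝ) : Prop where
  hu : MemLp u 2 volume
  hU : MemLp U 2 volume
  hf : MemLp f 2 volume
  hg : ∀ i, MemLp (g i) 2 volume
  grad : ∀ ζ : E → ℝ, ContDiff ℝ 1 ζ → ∀ L : Set E, IsCompact L → L ⊆ Q → (∀ z, z ∉ L → ζ z = 0) →
    ∀ i, ∫ z, U z * fderiv ℝ ζ z (d i) = -∫ z, g i z * ζ z
  eqn : ∀ ζ : E → ℝ, ContDiff ℝ 1 ζ → ∀ L : Set E, IsCompact L → L ⊆ Q → (∀ z, z ∉ L → ζ z = 0) →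
    -(∫ z, u z * fderiv ℝ ζ z e) + ∑ i, (∫ z, g i z * fderiv ℝ ζ z (d i)) + ∫ z, f z * ζ z = 0

lemma moll_pde {ι : Type*} [Fintype ι] {e : E} {d : ι → E} {Q : Set E} {u U f : E → ℝ}
    {g : ι → E → ℝ} (hS : WeakSys e d Q u U f g) (φ : ContDiffBump (0 : E)) (z : E)
    (hz : Metric.closedBall z φ.rOut ⊆ Q) :
    (∀ i, fderiv ℝ (moll φ U) z (d i) = moll φ (g i) z) ∧
    fderiv ℝ (moll φ u) z e = ∑ i, fderiv ℝ (moll φ (g i)) z (d i) - moll φ f z := by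
  let ζ : E → ℝ := fun y => φ.normed volume (z - y)
  have hζ : ContDiff ℝ 1 ζ := φ.contDiff_normed.comp (contDiff_const.sub contDiff_id)
  have hζ0 : ∀ y, y ∉ Metric.closedBall z φ.rOut → ζ y = 0 := by
    intro y hy
    have : z - y ∉ Function.support (φ.normed volume) := by
      rw [φ.support_normed_eq]
      intro h
      apply hy
      rw [Metric.mem_closedBall, dist_comm, dist_eq_norm]
      rw [mem_ball_zero_iff] at h
      exact h.le
    simpa using this
  have hd : ∀ y v, fderiv ℝ ζ y v = -(fderiv ℝ (φ.normed volume) (z - y) v) := by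
    intro y v
    have h1 : HasFDerivAt (fun y : E => z - y) (-(ContinuousLinearMap.id ℝ E)) y := by
      simpa using (hasFDerivAt_id y).const_sub z
    have h2 := (((φ.contDiff_normed (μ := volume) (n := 1)).differentiable one_ne_zero
      (z - y)).hasFDerivAt).comp y h1
    have h3 : HasFDerivAt ζ _ y := h2
    rw [h3.fderiv]; simp
  have hc := isCompact_closedBall z φ.rOut
  constructor
  · intro i
    have h1 := hS.grad ζ hζ _ hc hz hζ0 i
    rw [moll_fderiv φ (memLp_two_loc hS.hU), moll_eq]
    simp only [hd, mul_neg, integral_neg, neg_inj] at h1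
    rw [show (∫ y, fderiv ℝ (φ.normed volume) (z - y) (d i) * U y)
      = ∫ y, U y * fderiv ℝ (φ.normed volume) (z - y) (d i) by simp_rw [mul_comm], h1]
    simp_rw [mul_comm]; rfl
  · have h1 := hS.eqn ζ hζ _ hc hz hζ0
    rw [moll_fderiv φ (memLp_two_loc hS.hu), moll_eq]
    rw [Finset.sum_congr rfl (fun i _ => moll_fderiv φ (memLp_two_loc (hS.hg i)) z (d i))]
    simp only [hd, mul_neg, integral_neg, neg_neg, Finset.sum_neg_distrib] at h1
    have e1 : (∫ y, fderiv ℝ (φ.normed volume) (z - y) e * u y)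
      = ∫ y, u y * fderiv ℝ (φ.normed volume) (z - y) e := by simp_rw [mul_comm]
    have e2 : ∑ i, (∫ y, fderiv ℝ (φ.normed volume) (z - y) (d i) * g i y)
      = ∑ i, ∫ y, g i y * fderiv ℝ (φ.normed volume) (z - y) (d i) := by simp_rw [mul_comm]
    have e3 : ∫ y, f y * ζ y = ∫ y, φ.normed volume (z - y) * f y := by
      show ∫ y, f y * φ.normed volume (z - y) = _
      simp_rw [mul_comm]
    rw [e1, e2, ← e3]
    linarith

lemma limit_ineq {ι : Type*} [Fintype ι] {e : E} {d : ι → E} {Q : Set E} {u U f : E → ℝ}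
    {g : ι → E → ℝ} (hS : WeakSys e d Q u U f g) {V Θ : E → ℝ} {p : ι → E → ℝ}
    (hV : ContDiff ℝ 1 V) (hΘ : ContDiff ℝ 1 Θ) 
    (hp : ∀ i, ContDiff ℝ 1 (p i)) {K : Set E} (hK : IsCompact K) {h : ℝ} (hh : 0 < h)
    (hΘ0 : ∀ z, 0 ≤ Θ z) (hΘd : ∀ z i, fderiv ℝ Θ z (d i) = 0)
    (hVp : ∀ z i, fderiv ℝ V z (d i) = p i z)
    {ε M Cu Cf A δ : ℝ} (hε : 0 < ε)
    (hKQ : ∀ z ∈ K, ∀ r ∈ Icc 0 h, Metric.closedBall (z - r • e) ε ⊆ Q)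
    (hu0 : ∀ z, 0 ≤ u z) (huC : ∀ z, u z ≤ Cu) (hUM : ∀ z, U z ≤ M)
    (hf0 : ∀ z, 0 ≤ f z) (hfC : ∀ z, f z ≤ Cf)
    (hVM : ∀ z, z ∉ K → Θ z = 0 ∨ M ≤ V z)
    (hA1 : ∀ z, z ∈ K → Θ z * max (M - V z) 0 ≤ A)
    (hA2 : ∀ z, z ∈ K → Θ z * (max (M - V z) 0) ^ 2 ≤ A) (hA0 : 0 ≤ A) (hδ : 0 < δ)
    (hgδ : ∀ r ∈ Icc 0 h, ∀ i, ∫ z, (g i (z - r • e) - g i z) ^ 2 ≤ δ)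
    (hfδ : ∀ r ∈ Icc 0 h, ∫ z, (f (z - r • e) - f z) ^ 2 ≤ δ ^ 2) :
    ∫ z, Θ z * (max (U z - V z) 0) ^ 2 * (u z - u (z - h • e))
      ≤ h * ((∫ z, Θ z * (max (U z - V z) 0) ^ 2 * (∑ i, fderiv ℝ (p i) z (d i) - f z))
        + A * (δ * volume.real K + δ) + Fintype.card ι * (A * δ)) := by
  have lu := memLp_two_loc hS.hu
  have lU := memLp_two_loc hS.hU
  have lf := memLp_two_loc hS.hf
  have lg := fun i => memLp_two_loc (hS.hg i)
  have hVc := hV.continuous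
  have hΘc := hΘ.continuous
  have hp' : ∀ i, Continuous (fderiv ℝ (p i)) := fun i => (hp i).continuous_fderiv one_ne_zero
  let φ : ℕ → ContDiffBump (0 : E) := fun n =>
    ⟨ε / (n + 1) / 2, ε / (n + 1), by positivity, by
      have : 0 < ε / ((n : ℝ) + 1) := by positivity
      linarith⟩
  have hφε : ∀ n, (φ n).rOut ≤ ε := fun n => by
    show ε / (n + 1) ≤ ε
    exact div_le_self hε.le (by linarith [(Nat.cast_nonneg n : (0 : ℝ) ≤ n)])
  have hφ0 : Tendsto (fun n => (φ n).rOut) atTop (𝓝 0) := by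
    show Tendsto (fun n : ℕ => ε / ((n : ℝ) + 1)) atTop (𝓝 0)
    exact tendsto_const_nhds.div_atTop (tendsto_natCast_atTop_atTop.atTop_add tendsto_const_nhds)
  have hφK : ∀ᶠ n in atTop, (φ n).rOut ≤ 2 * (φ n).rIn := Eventually.of_forall fun n => by
    show ε / ((n : ℝ) + 1) ≤ 2 * (ε / (n + 1) / 2)
    linarith
  have cu := ContDiffBump.ae_convolution_tendsto_right_of_locallyIntegrable hφ0 hφK lu
  have cU := ContDiffBump.ae_convolution_tendsto_right_of_locallyIntegrable hφ0 hφK lU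
  have cf := ContDiffBump.ae_convolution_tendsto_right_of_locallyIntegrable hφ0 hφK lf
  have cus : ∀ᵐ z, Tendsto (fun n => moll (φ n) u (z - h • e)) atTop (𝓝 (u (z - h • e))) :=
    (measurePreserving_sub_right volume (h • e)).quasiMeasurePreserving.ae cu
  have mW : ∀ n z, moll (φ n) U z ≤ M := fun n z => moll_le _ lU hUM z
  have cWn : ∀ n, Continuous (moll (φ n) U) := fun n => (moll_contDiff (φ n) lU).continuous
  have cvn : ∀ n, Continuous (moll (φ n) u) := fun n => (moll_contDiff (φ n) lu).continuous
  have cFn : ∀ n, Continuous (moll (φ n) f) := fun n => (moll_contDiff (φ n) lf).continuous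
  have cGn : ∀ n i, Continuous (moll (φ n) (g i)) :=
    fun n i => (moll_contDiff (φ n) (lg i)).continuous
  have hWV : ∀ n z, z ∉ K → Θ z * max (moll (φ n) U z - V z) 0 = 0 := by
    intro n z hz
    rcases hVM z hz with h1 | h1
    · rw [h1, zero_mul]
    · rw [max_eq_right (by linarith [mW n z]), mul_zero]
  have hWV2 : ∀ n z, z ∉ K → Θ z * (max (moll (φ n) U z - V z) 0) ^ 2 = 0 := by
    intro n z hz
    rw [sq, ← mul_assoc, hWV n z hz, zero_mul]
  have hmax : ∀ n z, max (moll (φ n) U z - V z) 0 ≤ max (M - V z) 0 := fun n z =>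
    max_le_max (by linarith [mW n z]) le_rfl
  have hW1 : ∀ n z, Θ z * max (moll (φ n) U z - V z) 0 ≤ K.indicator (fun _ => A) z := by
    intro n z
    by_cases hz : z ∈ K
    · rw [indicator_of_mem hz]
      exact (mul_le_mul_of_nonneg_left (hmax n z) (hΘ0 z)).trans (hA1 z hz)
    · rw [indicator_of_notMem hz, hWV n z hz]
  have hW2 : ∀ n z, Θ z * (max (moll (φ n) U z - V z) 0) ^ 2 ≤ K.indicator (fun _ => A) z := by
    intro n z
    by_cases hz : z ∈ K
    · rw [indicator_of_mem hz]
      exact (mul_le_mul_of_nonneg_left (pow_le_pow_left₀ (le_max_right _ _) (hmax n z) 2)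
        (hΘ0 z)).trans (hA2 z hz)
    · rw [indicator_of_notMem hz, hWV2 n z hz]
  have hW20 : ∀ n z, 0 ≤ Θ z * (max (moll (φ n) U z - V z) 0) ^ 2 := fun n z =>
    mul_nonneg (hΘ0 z) (sq_nonneg _)
  have hW10 : ∀ n z, 0 ≤ Θ z * max (moll (φ n) U z - V z) 0 := fun n z =>
    mul_nonneg (hΘ0 z) (le_max_right _ _)
  have iK : ∀ c : ℝ, Integrable (K.indicator (fun _ => c)) := fun c =>
    (integrable_indicator_iff hK.measurableSet).2 (integrableOn_const hK.measure_lt_top.ne)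
  -- inequality at level n
  have lev : ∀ n, ∫ z, Θ z * (max (moll (φ n) U z - V z) 0) ^ 2
        * (moll (φ n) u z - moll (φ n) u (z - h • e))
      ≤ h * ((∫ z, Θ z * (max (moll (φ n) U z - V z) 0) ^ 2
          * (∑ i, fderiv ℝ (p i) z (d i) - moll (φ n) f z))
        + A * (δ * volume.real K + δ) + Fintype.card ι * (A * δ)) := by
    intro n
    have hb : ∀ z ∈ K, ∀ r ∈ Icc 0 h, Metric.closedBall (z - r • e) (φ n).rOut ⊆ Q :=
      fun z hz r hr => (Metric.closedBall_subset_closedBall (hφε n)).trans (hKQ z hz r hr)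
    obtain ⟨r, hr, hle⟩ := classical_ineq e d (moll_contDiff (φ n) lu) (moll_contDiff (φ n) lU)
      (cFn n) hV hΘ (fun i => moll_contDiff (φ n) (lg i)) hp hK hh hΘ0 hΘd (hWV n)
      (fun z hz i => by
        have := hb z hz 0 ⟨le_rfl, hh.le⟩
        rw [zero_smul, sub_zero] at this
        exact (moll_pde hS (φ n) z this).1 i) hVp
      (fun z hz r hr => (moll_pde hS (φ n) (z - r • e) (hb z hz r hr)).2)
    have hrI : r ∈ Icc 0 h := ⟨hr.1.le, hr.2.le⟩
    refine hle.trans (mul_le_mul_of_nonneg_left ?_ hh.le)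
    refine add_le_add (add_le_add le_rfl ?_) ?_
    · obtain ⟨i1, i2⟩ := moll_shift_sq (φ n) hS.hf (r • e)
      have i3 := i2.trans (hfδ r hrI)
      calc _ ≤ ∫ z, (K.indicator (fun _ => A * δ) z
              + (A / δ) * (moll (φ n) f (z - r • e) - moll (φ n) f z) ^ 2) := by
            refine integral_mono_of_nonneg (Eventually.of_forall fun z => ?_)
              ((iK _).add (i1.const_mul _)) (Eventually.of_forall fun z => ?_)
            · exact mul_nonneg (hW20 n z) (abs_nonneg _)
            · simp only
              set X := moll (φ n) f (z - r • e) - moll (φ n) f z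
              by_cases hz : z ∈ K
              · have h2 := hW2 n z
                rw [indicator_of_mem hz] at h2 ⊢
                have h3 : |X| ≤ δ + X ^ 2 / δ := by
                  rw [← sub_le_iff_le_add', le_div_iff₀ hδ, ← sq_abs X]
                  nlinarith [sq_nonneg (|X| - δ), abs_nonneg X]
                calc _ ≤ A * (δ + X ^ 2 / δ) := mul_le_mul h2 h3 (abs_nonneg _) hA0
                  _ = _ := by ring
              · rw [hWV2 n z hz, zero_mul, indicator_of_notMem hz]
                positivity
        _ = A * δ * volume.real K + (A / δ) *
              ∫ z, (moll (φ n) f (z - r • e) - moll (φ n) f z) ^ 2 := by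
            rw [integral_add (iK _) (i1.const_mul _), integral_const_mul,
              integral_indicator hK.measurableSet]
            simp [mul_comm]
        _ ≤ A * δ * volume.real K + (A / δ) * δ ^ 2 := by gcongr
        _ = _ := by field_simp
    · rw [← nsmul_eq_mul, ← Finset.card_univ]
      refine Finset.sum_le_card_nsmul _ _ _ fun i _ => ?_
      obtain ⟨i1, i2⟩ := moll_shift_sq (φ n) (hS.hg i) (r • e)
      have i3 := i2.trans (hgδ r hrI i)
      calc _ ≤ ∫ z, A * (moll (φ n) (g i) (z - r • e) - moll (φ n) (g i) z) ^ 2 := by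
            refine integral_mono_of_nonneg (Eventually.of_forall fun z => ?_)
              (i1.const_mul _) (Eventually.of_forall fun z => ?_)
            · exact mul_nonneg (mul_nonneg (by norm_num) (hW10 n z)) (sq_nonneg _)
            · refine mul_le_mul_of_nonneg_right ?_ (sq_nonneg _)
              have h2 : Θ z * max (moll (φ n) U z - V z) 0 ≤ A := (hW1 n z).trans
                (indicator_le_self' (fun _ _ => hA0) z)
              linarith [hW10 n z]
        _ ≤ A * δ := by rw [integral_const_mul]; gcongr
  -- limits
  have L1 : Tendsto (fun n => ∫ z, Θ z * (max (moll (φ n) U z - V z) 0) ^ 2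
        * (moll (φ n) u z - moll (φ n) u (z - h • e))) atTop
        (𝓝 (∫ z, Θ z * (max (U z - V z) 0) ^ 2 * (u z - u (z - h • e)))) := by
    refine tendsto_integral_of_dominated_convergence (K.indicator (fun _ => A * Cu)) ?_ (iK _) ?_ ?_
    · intro n
      have := cWn n
      have := cvn n
      exact Continuous.aestronglyMeasurable (by fun_prop)
    · intro n
      refine Eventually.of_forall fun z => ?_
      have b1 := moll_nonneg (φ n) hu0 z
      have b2 := moll_le (φ n) lu huC z
      have b3 := moll_nonneg (φ n) hu0 (z - h • e)
      have b4 := moll_le (φ n) lu huC (z - h • e)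
      have b5 : |moll (φ n) u z - moll (φ n) u (z - h • e)| ≤ Cu := by
        rw [abs_le]; constructor <;> linarith
      rw [norm_mul, Real.norm_of_nonneg (hW20 n z), Real.norm_eq_abs]
      by_cases hz : z ∈ K
      · have h2 := hW2 n z
        rw [indicator_of_mem hz] at h2 ⊢
        exact mul_le_mul h2 b5 (abs_nonneg _) hA0
      · rw [hWV2 n z hz, zero_mul, indicator_of_notMem hz]
    · filter_upwards [cu, cU, cus] with z a b c
      exact (((b.sub_const (V z)).max tendsto_const_nhds).pow 2).const_mul (Θ z) |>.mul (a.sub c)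
  obtain ⟨D, hD⟩ := hK.exists_bound_of_continuousOn (f := fun z => ∑ i, fderiv ℝ (p i) z (d i))
    (by fun_prop)
  have L2 : Tendsto (fun n => ∫ z, Θ z * (max (moll (φ n) U z - V z) 0) ^ 2
          * (∑ i, fderiv ℝ (p i) z (d i) - moll (φ n) f z)) atTop
        (𝓝 (∫ z, Θ z * (max (U z - V z) 0) ^ 2 * (∑ i, fderiv ℝ (p i) z (d i) - f z))) := by
    refine tendsto_integral_of_dominated_convergence (K.indicator (fun _ => A * (D + Cf))) ?_
      (iK _) ?_ ?_
    · intro n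
      have := cWn n
      have := cFn n
      exact Continuous.aestronglyMeasurable (by fun_prop)
    · intro n
      refine Eventually.of_forall fun z => ?_
      have b1 := moll_nonneg (φ n) hf0 z
      have b2 := moll_le (φ n) lf hfC z
      rw [norm_mul, Real.norm_of_nonneg (hW20 n z)]
      by_cases hz : z ∈ K
      · have h2 := hW2 n z
        rw [indicator_of_mem hz] at h2 ⊢
        refine mul_le_mul h2 ((norm_sub_le _ _).trans (add_le_add (hD z hz) ?_)) (norm_nonneg _) hA0
        rwa [Real.norm_of_nonneg b1]
      · rw [hWV2 n z hz, zero_mul, indicator_of_notMem hz]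
    · filter_upwards [cU, cf] with z b c
      exact (((b.sub_const (V z)).max tendsto_const_nhds).pow 2).const_mul (Θ z) |>.mul
        (c.const_sub _)
  exact le_of_tendsto_of_tendsto' L1 (((L2.add_const _).add_const _).const_mul h) lev
end limit
end part3

section part4
open Filter Topology
set_option linter.unusedSectionVars false

section phi

def Phi (m V u : ℝ) : ℝ := ∫ r in (0:ℝ)..u, (max (r ^ m - V) 0) ^ 2
def Kap (m V u : ℝ) : ℝ := ∫ r in (0:ℝ)..u, max (r ^ m - V) 0

variable {m : ℝ}

lemma cont_rm (hm : 1 < m) : Continuous (fun r : ℝ => r ^ m) :=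
  Real.continuous_rpow_const (by linarith)

lemma phi_cont (hm : 1 < m) : Continuous (fun z : ℝ × ℝ => Phi m z.1 z.2) := by
  have := cont_rm hm
  refine intervalIntegral.continuous_parametric_intervalIntegral_of_continuous
    (f := fun (z : ℝ × ℝ) r => (max (r ^ m - z.1) 0) ^ 2) (s := fun z => z.2) ?_ continuous_snd
  have h2 : Continuous (fun z : (ℝ × ℝ) × ℝ => z.2 ^ m) := this.comp continuous_snd
  simp only [Function.uncurry_def]
  fun_prop

lemma kap_cont (hm : 1 < m) : Continuous (fun z : ℝ × ℝ => Kap m z.1 z.2) := by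
  have := cont_rm hm
  refine intervalIntegral.continuous_parametric_intervalIntegral_of_continuous
    (f := fun (z : ℝ × ℝ) r => max (r ^ m - z.1) 0) (s := fun z => z.2) ?_ continuous_snd
  have h2 : Continuous (fun z : (ℝ × ℝ) × ℝ => z.2 ^ m) := this.comp continuous_snd
  simp only [Function.uncurry_def]
  fun_prop

lemma phi_ii (hm : 1 < m) (V a b : ℝ) :
    IntervalIntegrable (fun r : ℝ => (max (r ^ m - V) 0) ^ 2) volume a b := by
  have := cont_rm hm
  exact Continuous.intervalIntegrable (by fun_prop) _ _

lemma kap_ii (hm : 1 < m) (V a b : ℝ) :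
    IntervalIntegrable (fun r : ℝ => max (r ^ m - V) 0) volume a b := by
  have := cont_rm hm
  exact Continuous.intervalIntegrable (by fun_prop) _ _

lemma rm_mono (hm : 1 < m) (V : ℝ) {r s : ℝ} (hr : 0 ≤ r) (hrs : r ≤ s) :
    max (r ^ m - V) 0 ≤ max (s ^ m - V) 0 := by
  have := Real.rpow_le_rpow hr hrs (by linarith : 0 ≤ m)
  exact max_le_max (by linarith) le_rfl

lemma phi_p1 (hm : 1 < m) (V : ℝ) {u0 u1 : ℝ} (h0 : 0 ≤ u0) (h1 : 0 ≤ u1) :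
    Phi m V u1 - Phi m V u0 ≤ (max (u1 ^ m - V) 0) ^ 2 * (u1 - u0) := by
  unfold Phi
  rw [intervalIntegral.integral_interval_sub_left (phi_ii hm V _ _) (phi_ii hm V _ _)]
  rcases le_total u0 u1 with h | h
  · have := intervalIntegral.integral_mono_on h (phi_ii hm V u0 u1)
      (intervalIntegrable_const (c := (max (u1 ^ m - V) 0) ^ 2)) (fun r hr => by
        have := rm_mono hm V (h0.trans hr.1) hr.2
        have h3 : 0 ≤ max (r ^ m - V) 0 := le_max_right _ _
        gcongr)
    rw [intervalIntegral.integral_const, smul_eq_mul] at this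
    linarith
  · have := intervalIntegral.integral_mono_on h 
      (intervalIntegrable_const (c := (max (u1 ^ m - V) 0) ^ 2)) (phi_ii hm V u1 u0) (fun r hr => by
        have := rm_mono hm V h1 hr.1
        have h3 : 0 ≤ max (u1 ^ m - V) 0 := le_max_right _ _
        gcongr)
    rw [intervalIntegral.integral_const, smul_eq_mul] at this
    rw [intervalIntegral.integral_symm]
    linarith

lemma phi_p2 (hm : 1 < m) {V0 V1 u : ℝ} (hV : V1 ≤ V0) (hu : 0 ≤ u) :
    Phi m V1 u - Phi m V0 u ≤ 2 * (V0 - V1) * Kap m V0 u + (V0 - V1) ^ 2 * u := by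
  unfold Phi Kap
  rw [← intervalIntegral.integral_sub (phi_ii hm _ _ _) (phi_ii hm _ _ _)]
  have e : 2 * (V0 - V1) * (∫ r in (0:ℝ)..u, max (r ^ m - V0) 0) + (V0 - V1) ^ 2 * u
    = ∫ r in (0:ℝ)..u, (2 * (V0 - V1) * max (r ^ m - V0) 0 + (V0 - V1) ^ 2) := by
    rw [intervalIntegral.integral_add ((kap_ii hm _ _ _).const_mul _) intervalIntegrable_const,
      intervalIntegral.integral_const_mul, intervalIntegral.integral_const, smul_eq_mul]
    ring
  rw [e]
  refine intervalIntegral.integral_mono_on hu ((phi_ii hm _ _ _).sub (phi_ii hm _ _ _))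
    (((kap_ii hm _ _ _).const_mul _).add intervalIntegrable_const) fun r _ => ?_
  have h1 : max (r ^ m - V1) 0 ≤ max (r ^ m - V0) 0 + (V0 - V1) := by
    have a1 := le_max_left (r ^ m - V0) 0
    have a2 := le_max_right (r ^ m - V0) 0
    exact max_le (by linarith) (by linarith)
  have h2 : 0 ≤ max (r ^ m - V1) 0 := le_max_right _ _
  nlinarith [pow_le_pow_left₀ h2 h1 2]

lemma phi_nonneg (V : ℝ) {u : ℝ} (hu : 0 ≤ u) : 0 ≤ Phi m V u :=
  intervalIntegral.integral_nonneg hu fun _ _ => sq_nonneg _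

lemma kap_nonneg (V : ℝ) {u : ℝ} (hu : 0 ≤ u) : 0 ≤ Kap m V u :=
  intervalIntegral.integral_nonneg hu fun _ _ => le_max_right _ _

lemma phi_le (hm : 1 < m) {V u : ℝ} (hu : 0 ≤ u) : Phi m V u ≤ (max (u ^ m - V) 0) ^ 2 * u := by
  have := phi_p1 hm V le_rfl hu
  simpa [Phi] using this

lemma kap_le (hm : 1 < m) {V u v : ℝ} (hv : 0 ≤ v) (hvu : v ≤ u) (hV : v ^ m ≤ V) :
    Kap m V u ≤ max (u ^ m - V) 0 * (u - v) := by
  unfold Kap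
  rw [← intervalIntegral.integral_add_adjacent_intervals (kap_ii hm V 0 v) (kap_ii hm V v u)]
  have z : ∫ r in (0:ℝ)..v, max (r ^ m - V) 0 = 0 := by
    rw [intervalIntegral.integral_congr (g := fun _ => (0:ℝ))]
    · simp
    · intro r hr
      rw [uIcc_of_le hv] at hr
      have := Real.rpow_le_rpow hr.1 hr.2 (by linarith : 0 ≤ m)
      exact max_eq_right (by linarith)
  rw [z, zero_add]
  have := intervalIntegral.integral_mono_on hvu (kap_ii hm V v u)
      (intervalIntegrable_const (c := max (u ^ m - V) 0)) (fun r hr =>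
        rm_mono hm V (hv.trans hr.1) hr.2)
  rw [intervalIntegral.integral_const, smul_eq_mul] at this
  linarith

lemma kap_zero (hm : 1 < m) {V u : ℝ} (hu : 0 ≤ u) (hV : u ^ m ≤ V) : Kap m V u = 0 :=
  le_antisymm (by simpa using kap_le hm hu le_rfl hV) (kap_nonneg V hu)

lemma phi_zero (hm : 1 < m) {V u : ℝ} (hu : 0 ≤ u) (hV : u ^ m ≤ V) : Phi m V u = 0 :=
  le_antisymm (by
    have := phi_le hm (V := V) hu
    rw [max_eq_right (by linarith)] at this
    simpa using this) (phi_nonneg V hu)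

lemma kap_p2 (hm : 1 < m) {V u : ℝ} (hV : 0 ≤ V) (hu : 0 ≤ u) :
    V ^ ((m - 1) / m) * Kap m V u ≤ (max (u ^ m - V) 0) ^ 2 := by
  rcases le_or_gt (u ^ m) V with h | h
  · rw [kap_zero hm hu h, mul_zero]; positivity
  · have hm0 : 0 < m := by linarith
    set v := V ^ (1 / m) with hv
    have hv0 : 0 ≤ v := by positivity
    have hvm : v ^ m = V := by
      rw [hv, ← Real.rpow_mul hV]; simp [hm0.ne']
    have hvu : v ≤ u := by
      by_contra hc
      have := Real.rpow_le_rpow hu (not_le.1 hc).le hm0.le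
      linarith
    have e : V ^ ((m - 1) / m) = v ^ (m - 1) := by
      rw [hv, ← Real.rpow_mul hV]; congr 1; ring
    have k := kap_le hm hv0 hvu hvm.le
    have h1 : v ^ (m - 1) * u ≤ u ^ m := by
      rcases hu.eq_or_lt with h0 | h0
      · rw [← h0]; simp [Real.zero_rpow hm0.ne']
      · have : u ^ m = u ^ (m - 1) * u := by
          rw [← Real.rpow_add_one h0.ne']; congr 1; ring
        rw [this]
        exact mul_le_mul_of_nonneg_right (Real.rpow_le_rpow hv0 hvu (by linarith)) hu
    have h2 : v ^ (m - 1) * v = V := by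
      rcases hv0.eq_or_lt with h0 | h0
      · rw [← h0] at hvm ⊢
        rw [← hvm, Real.zero_rpow hm0.ne']; simp
      · rw [← Real.rpow_add_one h0.ne', ← hvm]; congr 1; ring
    have hmx : max (u ^ m - V) 0 = u ^ m - V := max_eq_left (by linarith)
    rw [hmx] at k ⊢
    rw [e]
    have h3 : 0 ≤ v ^ (m - 1) := by positivity
    calc v ^ (m - 1) * Kap m V u ≤ v ^ (m - 1) * ((u ^ m - V) * (u - v)) := by gcongr
      _ = (u ^ m - V) * (v ^ (m - 1) * u - v ^ (m - 1) * v) := by ring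
      _ ≤ (u ^ m - V) * (u ^ m - V) := by
        apply mul_le_mul_of_nonneg_left _ (by linarith)
        linarith
      _ = _ := by ring

lemma phi_pos (hm : 1 < m) {V u : ℝ} (hu : 0 ≤ u) (h : Phi m V u ≤ 0) (hV : 0 ≤ V) : u ^ m ≤ V := by
  by_contra hc
  push Not at hc
  have hm0 : 0 < m := by linarith
  have hu0 : 0 < u := by
    rcases hu.eq_or_lt with h0 | h0
    · rw [← h0, Real.zero_rpow hm0.ne'] at hc; linarith
    · exact h0
  have := cont_rm hm
  have : 0 < Phi m V u := by
    apply intervalIntegral.integral_pos hu0 (Continuous.continuousOn (by fun_prop))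
      (fun _ _ => sq_nonneg _)
    refine ⟨u, ⟨hu, le_rfl⟩, ?_⟩
    have : 0 < max (u ^ m - V) 0 := lt_max_of_lt_left (by linarith)
    positivity
  linarith

end phi
end part4

section part5
open Filter Topology
set_option linter.unusedSectionVars false

section cmp
variable {E : Type*} [NormedAddCommGroup E] [NormedSpace ℝ E] [FiniteDimensional ℝ E]
  [MeasureSpace E] [BorelSpace E] [(volume : Measure E).IsAddHaarMeasure]

lemma int_of_K {K : Set E} (hK : IsCompact K) {F : E → ℝ} (hm : AEStronglyMeasurable F volume)
    {A : ℝ} (h0 : ∀ z, z ∉ K → F z = 0) (hA : ∀ z, z ∈ K → |F z| ≤ A) : Integrable F volume := by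
  have h1 : IntegrableOn F K volume :=
    Measure.integrableOn_of_bounded (M := A) hK.measure_lt_top.ne hm
      (ae_restrict_of_forall_mem hK.measurableSet fun z hz => hA z hz)
  refine (integrableOn_iff_integrable_of_support_subset ?_).1 h1
  intro z hz
  by_contra hc
  exact hz (h0 z hc)

set_option maxHeartbeats 2000000 in
lemma comparison {ι : Type*} [Fintype ι] {e : E} {d : ι → E} {Q : Set E} {m : ℝ} (hm : 1 < m)
    {u U f : E → ℝ}
    {g : ι → E → ℝ} (hS : WeakSys e d Q u U f g) (hUu : ∀ z, U z = u z ^ m) {V Θ θ b : E → ℝ}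
    {p : ι → E → ℝ}
    (hV : ContDiff ℝ 1 V) (hΘ : ContDiff ℝ 1 Θ) (hb : Continuous b) (hθ : Continuous θ)
    (hp : ∀ i, ContDiff ℝ 1 (p i)) {K : Set E} (hK : IsCompact K) {h1 : ℝ} (hh : 0 < h1)
    (hΘ0 : ∀ z, 0 ≤ Θ z) (hθ0 : ∀ z, 0 ≤ θ z) (hV0 : ∀ z, 0 ≤ V z)
    (hb0 : ∀ z, 0 ≤ b z) {bm : ℝ} (hbm0 : 0 ≤ bm)
    (hbm : ∀ z ∈ K, ∀ r ∈ Icc 0 h1, b (z - r • e) ≤ bm)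
    (hΘd : ∀ z i, fderiv ℝ Θ z (d i) = 0)
    (hVp : ∀ z i, fderiv ℝ V z (d i) = p i z)
    {ε M Cu Cf : ℝ} (hε : 0 < ε)
    (hKQ : ∀ z ∈ K, ∀ r ∈ Icc 0 h1, Metric.closedBall (z - r • e) ε ⊆ Q)
    (hu0 : ∀ z, 0 ≤ u z) (huC : ∀ z, u z ≤ Cu) (hUM : ∀ z, U z ≤ M)
    (hf0 : ∀ z, 0 ≤ f z) (hfC : ∀ z, f z ≤ Cf)
    (hVM : ∀ z, z ∉ K → Θ z = 0 ∨ M ≤ V z)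
    (hVs : ∀ z, ∀ r ∈ Ioc 0 h1, V z ≤ V (z - r • e))
    (hVb : ∀ z, ∀ r ∈ Ioc 0 h1, V (z - r • e) - V z ≤ r * b (z - r • e))
    (hΘs : ∀ z, ∀ r ∈ Ioc 0 h1, r * θ z ≤ Θ z - Θ (z + r • e))
    (hmain : ∀ z ∈ K, V z < U z →
      (max (U z - V z) 0) ^ 2 * (∑ i, fderiv ℝ (p i) z (d i) - f z)
        + 2 * (b z * Kap m (V z) (u z)) ≤ 0) :
    ∀ᵐ z, 0 < θ z → U z ≤ V z := by
  have hVc := hV.continuous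
  have hΘc := hΘ.continuous
  have hp' : ∀ i, Continuous (fderiv ℝ (p i)) := fun i => (hp i).continuous_fderiv one_ne_zero
  have mu := hS.hu.1
  have mU := hS.hU.1
  have mf := hS.hf.1
  have hCu : 0 ≤ Cu := (hu0 0).trans (huC 0)
  -- constants
  obtain ⟨A1, hA1⟩ := hK.exists_bound_of_continuousOn (f := fun z => Θ z * max (M - V z) 0)
    (Continuous.continuousOn (by fun_prop))
  obtain ⟨A2, hA2⟩ := hK.exists_bound_of_continuousOn (f := fun z => Θ z * (max (M - V z) 0) ^ 2)
    (Continuous.continuousOn (by fun_prop))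
  obtain ⟨A3, hA3⟩ := hK.exists_bound_of_continuousOn (f := Θ) hΘc.continuousOn
  obtain ⟨D, hD⟩ := hK.exists_bound_of_continuousOn
    (f := fun z => ∑ i, fderiv ℝ (p i) z (d i))
    (Continuous.continuousOn (continuous_finsetSum _ fun i _ => (hp' i).clm_apply continuous_const))
  set A := max (max A1 A2) (max A3 0) with hA
  have hA0 : 0 ≤ A := (le_max_right A3 0).trans (le_max_right _ _)
  have hA1' : ∀ z ∈ K, Θ z * max (M - V z) 0 ≤ A := fun z hz =>
    (le_abs_self _).trans ((hA1 z hz).trans ((le_max_left A1 A2).trans (le_max_left _ _)))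
  have hA2' : ∀ z ∈ K, Θ z * (max (M - V z) 0) ^ 2 ≤ A := fun z hz =>
    (le_abs_self _).trans ((hA2 z hz).trans ((le_max_right A1 A2).trans (le_max_left _ _)))
  have hA3' : ∀ z ∈ K, Θ z ≤ A := fun z hz =>
    (le_abs_self _).trans ((hA3 z hz).trans ((le_max_left A3 0).trans (le_max_right _ _)))
  -- vanishing outside K
  have hmx0 : ∀ z, z ∉ K → Θ z = 0 ∨ U z ≤ V z := fun z hz =>
    (hVM z hz).imp id fun h => (hUM z).trans h
  have hmx : ∀ z, max (U z - V z) 0 ≤ max (M - V z) 0 := fun z =>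
    max_le_max (by linarith [hUM z]) le_rfl
  have hmxn : ∀ z, 0 ≤ max (U z - V z) 0 := fun z => le_max_right _ _
  have hH0 : ∀ z, z ∉ K → Θ z * (max (U z - V z) 0) ^ 2 = 0 := by
    intro z hz
    rcases hmx0 z hz with h | h
    · rw [h, zero_mul]
    · rw [max_eq_right (by linarith)]; simp
  have hHA : ∀ z ∈ K, Θ z * (max (U z - V z) 0) ^ 2 ≤ A := fun z hz =>
    (mul_le_mul_of_nonneg_left (pow_le_pow_left₀ (hmxn z) (hmx z) 2) (hΘ0 z)).trans (hA2' z hz)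
  have hHn : ∀ z, 0 ≤ Θ z * (max (U z - V z) 0) ^ 2 := fun z => mul_nonneg (hΘ0 z) (sq_nonneg _)
  have mH : AEStronglyMeasurable (fun z => Θ z * (max (U z - V z) 0) ^ 2) volume := by
    refine hΘc.aestronglyMeasurable.mul (((continuous_id.max continuous_const).pow 2
      ).comp_aestronglyMeasurable (mU.sub hVc.aestronglyMeasurable))
  let Ψ : E → ℝ := fun z => Phi m (V z) (u z)
  let κ : E → ℝ := fun z => Kap m (V z) (u z)
  have mΨ : AEStronglyMeasurable Ψ volume :=
    (phi_cont hm).comp_aestronglyMeasurable (hVc.aestronglyMeasurable.prodMk mu)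
  have mκ : AEStronglyMeasurable κ volume :=
    (kap_cont hm).comp_aestronglyMeasurable (hVc.aestronglyMeasurable.prodMk mu)
  have hΨ0 : ∀ z, 0 ≤ Ψ z := fun z => phi_nonneg _ (hu0 z)
  have hκ0 : ∀ z, 0 ≤ κ z := fun z => kap_nonneg _ (hu0 z)
  have iΘΨ : Integrable (fun z => Θ z * Ψ z) volume := by
    refine int_of_K hK (A := A * Cu) (hΘc.aestronglyMeasurable.mul mΨ) ?_ ?_
    · intro z hz
      rcases hmx0 z hz with h | h
      · rw [h, zero_mul]
      · show Θ z * Phi m (V z) (u z) = 0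
        rw [phi_zero hm (hu0 z) (by rw [← hUu]; exact h), mul_zero]
    · intro z hz
      rw [abs_of_nonneg (mul_nonneg (hΘ0 z) (hΨ0 z))]
      have h2 := phi_le hm (V := V z) (hu0 z)
      rw [← hUu] at h2
      calc Θ z * Ψ z ≤ Θ z * ((max (U z - V z) 0) ^ 2 * u z) := by
            gcongr
            exact hΘ0 z
        _ = Θ z * (max (U z - V z) 0) ^ 2 * u z := by ring
        _ ≤ A * Cu := mul_le_mul (hHA z hz) (huC z) (hu0 z) hA0
  have iΘκ : Integrable (fun z => Θ z * (b z * κ z)) volume := by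
    refine int_of_K hK (A := bm * (A * Cu)) (hΘc.aestronglyMeasurable.mul
      (hb.aestronglyMeasurable.mul mκ)) ?_ ?_
    · intro z hz
      rcases hmx0 z hz with h | h
      · rw [h, zero_mul]
      · show Θ z * (b z * Kap m (V z) (u z)) = 0
        rw [kap_zero hm (hu0 z) (by rw [← hUu]; exact h), mul_zero, mul_zero]
    · intro z hz
      rw [abs_of_nonneg (mul_nonneg (hΘ0 z) (mul_nonneg (hb0 z) (hκ0 z)))]
      have h2 := kap_le hm (V := V z) le_rfl (hu0 z)
        (by rw [Real.zero_rpow (by linarith)]; exact hV0 z)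
      rw [← hUu, sub_zero] at h2
      have h3 : Θ z * κ z ≤ A * Cu := calc
        Θ z * κ z ≤ Θ z * (max (U z - V z) 0 * u z) := mul_le_mul_of_nonneg_left h2 (hΘ0 z)
        _ = Θ z * max (U z - V z) 0 * u z := by ring
        _ ≤ A * Cu := mul_le_mul ((mul_le_mul_of_nonneg_left (hmx z) (hΘ0 z)).trans (hA1' z hz))
            (huC z) (hu0 z) hA0
      calc Θ z * (b z * κ z) = b z * (Θ z * κ z) := by ring
        _ ≤ bm * (A * Cu) := mul_le_mul (by simpa using hbm z hz 0 ⟨le_rfl, hh.le⟩) h3 (mul_nonneg (hΘ0 z) (hκ0 z)) hbm0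
  have iHf : Integrable (fun z => Θ z * (max (U z - V z) 0) ^ 2 *
      (∑ i, fderiv ℝ (p i) z (d i) - f z)) volume := by
    refine int_of_K hK (A := A * (D + Cf)) (mH.mul (Continuous.aestronglyMeasurable
      (continuous_finsetSum _ fun i _ => (hp' i).clm_apply continuous_const) |>.sub mf)) ?_ ?_
    · intro z hz
      rw [hH0 z hz, zero_mul]
    · intro z hz
      rw [abs_mul, abs_of_nonneg (hHn z)]
      refine mul_le_mul (hHA z hz) ((norm_sub_le _ _).trans (add_le_add (hD z hz) ?_))
        (abs_nonneg _) hA0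
      rw [Real.norm_of_nonneg (hf0 z)]
      exact hfC z
  have main0 : (∫ z, Θ z * (max (U z - V z) 0) ^ 2 * (∑ i, fderiv ℝ (p i) z (d i) - f z))
      + 2 * (∫ z, Θ z * (b z * κ z)) ≤ 0 := by
    rw [← integral_const_mul, ← integral_add iHf (iΘκ.const_mul 2)]
    refine integral_nonpos fun z => ?_
    show Θ z * (max (U z - V z) 0) ^ 2 * (∑ i, fderiv ℝ (p i) z (d i) - f z)
      + 2 * (Θ z * (b z * κ z)) ≤ 0
    have key : Θ z = 0 ∨ (max (U z - V z) 0) ^ 2 * (∑ i, fderiv ℝ (p i) z (d i) - f z)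
        + 2 * (b z * κ z) ≤ 0 := by
      by_cases hUV : V z < U z
      · by_cases hz : z ∈ K
        · exact Or.inr (hmain z hz hUV)
        · rcases hmx0 z hz with h | h
          · exact Or.inl h
          · exact absurd hUV (not_lt.2 h)
      · right
        push Not at hUV
        have : κ z = 0 := kap_zero hm (hu0 z) (by rw [← hUu]; exact hUV)
        rw [this, max_eq_right (by linarith)]; simp
    rcases key with h | h
    · rw [h]; simp
    · have := mul_nonpos_of_nonneg_of_nonpos (hΘ0 z) h
      linarith
  have iθ : Integrable (fun z => θ z * Ψ z) volume := by
    refine Integrable.mono' (iΘΨ.const_mul (1 / h1)) (hθ.aestronglyMeasurable.mul mΨ)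
      (Eventually.of_forall fun z => ?_)
    rw [Real.norm_of_nonneg (mul_nonneg (hθ0 z) (hΨ0 z))]
    have h2 := hΘs z h1 ⟨hh, le_rfl⟩
    have h3 : θ z ≤ 1 / h1 * Θ z := by
      rw [one_div, ← div_eq_inv_mul, le_div_iff₀ hh]
      linarith [hΘ0 (z + h1 • e)]
    rw [← mul_assoc]
    exact mul_le_mul_of_nonneg_right h3 (hΨ0 z)
  -- estimate for fixed δ
  set c2 := bm ^ 2 * Cu * A * volume.real K with hc2
  have hc20 : 0 ≤ c2 := by positivity
  have est : ∀ δ : ℝ, 0 < δ → ∫ z, θ z * Ψ z ≤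
      A * (δ * volume.real K + δ) + Fintype.card ι * (A * δ) + δ * c2 := by
    intro δ hδ
    obtain ⟨k0, hk0, hk⟩ := trans_cont hS.hf e (pow_pos hδ 2)
    have hex : ∃ l0 > 0, ∀ i, ∀ r : ℝ, |r| ≤ l0 → ∫ z, (g i (z - r • e) - g i z) ^ 2 ≤ δ := by
      choose l hl hl2 using fun i => trans_cont (hS.hg i) e hδ
      rcases isEmpty_or_nonempty ι with hι | hι
      · exact ⟨1, one_pos, fun i => hι.elim i⟩
      · refine ⟨Finset.univ.inf' Finset.univ_nonempty l, ?_, fun i r hr => hl2 i r (hr.trans ?_)⟩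
        · rw [gt_iff_lt, Finset.lt_inf'_iff]; exact fun i _ => hl i
        · exact Finset.inf'_le _ (Finset.mem_univ i)
    obtain ⟨l0, hl0, hl⟩ := hex
    set h := min (min k0 l0) (min δ h1) with hhdef
    have hpos : 0 < h := lt_min (lt_min hk0 hl0) (lt_min hδ hh)
    have hhk : h ≤ k0 := (min_le_left _ _).trans (min_le_left _ _)
    have hhl : h ≤ l0 := (min_le_left _ _).trans (min_le_right _ _)
    have hhδ : h ≤ δ := (min_le_right _ _).trans (min_le_left _ _)
    have hhh : h ≤ h1 := (min_le_right _ _).trans (min_le_right _ _)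
    have hI := limit_ineq hS hV hΘ hp hK hpos hΘ0 hΘd hVp hε
      (fun z hz r hr => hKQ z hz r ⟨hr.1, hr.2.trans hhh⟩) hu0 huC hUM hf0 hfC hVM hA1' hA2' hA0 hδ
      (fun r hr i => hl i r (by rw [abs_of_nonneg hr.1]; exact hr.2.trans hhl))
      (fun r hr => hk r (by rw [abs_of_nonneg hr.1]; exact hr.2.trans hhk))
    have hmem : h ∈ Ioc 0 h1 := ⟨hpos, hhh⟩
    have mp := measurePreserving_sub_right (volume : Measure E) (h • e)
    have mus : AEStronglyMeasurable (fun z => u (z - h • e)) volume :=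
      mu.comp_measurePreserving mp
    have iI : Integrable (fun z => Θ z * (max (U z - V z) 0) ^ 2 * (u z - u (z - h • e))) volume := by
      refine int_of_K hK (A := A * Cu) (mH.mul (mu.sub mus)) ?_ ?_
      · intro z hz
        rw [hH0 z hz, zero_mul]
      · intro z hz
        rw [abs_mul, abs_of_nonneg (hHn z)]
        refine mul_le_mul (hHA z hz) (abs_le.2 ⟨?_, ?_⟩) (abs_nonneg _) hA0
        · linarith [hu0 z, huC (z - h • e)]
        · linarith [huC z, hu0 (z - h • e)]
    have hΘmono : ∀ z, Θ (z + h • e) ≤ Θ z := fun z => by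
      have := hΘs z h hmem
      have := mul_nonneg hpos.le (hθ0 z)
      linarith
    have hΘsc : Continuous fun z => Θ (z + h • e) := hΘc.comp (continuous_add_const _)
    have iΨs : Integrable (fun z => Θ (z + h • e) * Ψ z) volume := by
      refine Integrable.mono' iΘΨ (hΘsc.aestronglyMeasurable.mul mΨ) (Eventually.of_forall fun z => ?_)
      rw [Real.norm_of_nonneg (mul_nonneg (hΘ0 _) (hΨ0 z))]
      exact mul_le_mul_of_nonneg_right (hΘmono z) (hΨ0 z)
    have iκs : Integrable (fun z => Θ (z + h • e) * (b z * κ z)) volume := by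
      refine Integrable.mono' iΘκ (hΘsc.aestronglyMeasurable.mul (hb.aestronglyMeasurable.mul mκ))
        (Eventually.of_forall fun z => ?_)
      rw [Real.norm_of_nonneg (mul_nonneg (hΘ0 _) (mul_nonneg (hb0 z) (hκ0 z)))]
      exact mul_le_mul_of_nonneg_right (hΘmono z) (mul_nonneg (hb0 z) (hκ0 z))
    have sΨ : ∫ z, Θ z * Ψ (z - h • e) = ∫ z, Θ (z + h • e) * Ψ z := by
      rw [← integral_sub_right_eq_self (fun z => Θ (z + h • e) * Ψ z) (h • e)]
      simp
    have sκ : ∫ z, Θ z * (b (z - h • e) * κ (z - h • e)) = ∫ z, Θ (z + h • e) * (b z * κ z) := by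
      rw [← integral_sub_right_eq_self (fun z => Θ (z + h • e) * (b z * κ z)) (h • e)]
      simp
    have iΨs' : Integrable (fun z => Θ z * Ψ (z - h • e)) volume := by
      have := mp.integrable_comp_of_integrable iΨs
      simpa [Function.comp_def] using this
    have iκs' : Integrable (fun z => Θ z * (b (z - h • e) * κ (z - h • e))) volume := by
      have := mp.integrable_comp_of_integrable iκs
      simpa [Function.comp_def] using this
    have iK : Integrable (K.indicator fun _ : E => h ^ 2 * bm ^ 2 * Cu * A) volume :=
      (integrable_indicator_iff hK.measurableSet).2 (integrableOn_const hK.measure_lt_top.ne)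
    have pw : ∀ z, Θ z * Ψ z - Θ z * Ψ (z - h • e) ≤
        (Θ z * (max (U z - V z) 0) ^ 2 * (u z - u (z - h • e))
          + 2 * h * (Θ z * (b (z - h • e) * κ (z - h • e))))
          + K.indicator (fun _ : E => h ^ 2 * bm ^ 2 * Cu * A) z := by
      intro z
      have a1 := phi_p1 hm (V z) (hu0 (z - h • e)) (hu0 z)
      rw [← hUu] at a1
      have a1' := mul_le_mul_of_nonneg_left a1 (hΘ0 z)
      have a2 : Θ z * (Phi m (V z) (u (z - h • e)) - Phi m (V (z - h • e)) (u (z - h • e))) ≤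
          2 * h * (Θ z * (b (z - h • e) * κ (z - h • e)))
          + K.indicator (fun _ : E => h ^ 2 * bm ^ 2 * Cu * A) z := by
        have n1 : 0 ≤ 2 * h * (Θ z * (b (z - h • e) * κ (z - h • e))) :=
          mul_nonneg (by positivity) (mul_nonneg (hΘ0 _) (mul_nonneg (hb0 _) (hκ0 _)))
        by_cases hz : z ∈ K
        · rw [indicator_of_mem hz]
          have b1 := phi_p2 hm (hVs z h hmem) (hu0 (z - h • e))
          have b2 := hVb z h hmem
          have b3 : 0 ≤ V (z - h • e) - V z := by linarith [hVs z h hmem]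
          have b4 : V (z - h • e) - V z ≤ h * bm :=
            b2.trans (mul_le_mul_of_nonneg_left (hbm z hz h ⟨hpos.le, hhh⟩) hpos.le)
          have b5 : (V (z - h • e) - V z) ^ 2 * u (z - h • e) ≤ (h * bm) ^ 2 * Cu :=
            mul_le_mul (pow_le_pow_left₀ b3 b4 2) (huC _) (hu0 _) (sq_nonneg _)
          have b6 : 2 * (V (z - h • e) - V z) * Kap m (V (z - h • e)) (u (z - h • e)) ≤
              2 * (h * b (z - h • e)) * Kap m (V (z - h • e)) (u (z - h • e)) :=
            mul_le_mul_of_nonneg_right (by linarith) (hκ0 (z - h • e))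
          have b7 : Θ z * ((h * bm) ^ 2 * Cu) ≤ A * ((h * bm) ^ 2 * Cu) :=
            mul_le_mul_of_nonneg_right (hA3' z hz) (by positivity)
          have b8 := mul_le_mul_of_nonneg_left (b1.trans (add_le_add b6 b5)) (hΘ0 z)
          have : κ (z - h • e) = Kap m (V (z - h • e)) (u (z - h • e)) := rfl
          rw [this]
          nlinarith [b8, b7]
        · rw [indicator_of_notMem hz, add_zero]
          rcases hVM z hz with h3 | h3
          · rw [h3]; simp
          · have v1 := hVs z h hmem
            have v2 : u (z - h • e) ^ m ≤ M := by rw [← hUu]; exact hUM _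
            rw [phi_zero hm (hu0 _) (v2.trans h3), phi_zero hm (hu0 _) (v2.trans (h3.trans v1))]
            simpa using n1
      have e1 : Ψ z = Phi m (V z) (u z) := rfl
      have e2 : Ψ (z - h • e) = Phi m (V (z - h • e)) (u (z - h • e)) := rfl
      rw [e1, e2]
      linarith [a1', a2]
    have J := integral_mono (iΘΨ.sub iΨs') ((iI.add (iκs'.const_mul (2 * h))).add iK) pw
    have J1 : ∫ z, (Θ z * Ψ z - Θ z * Ψ (z - h • e)) = (∫ z, Θ z * Ψ z) - ∫ z, Θ (z + h • e) * Ψ z := by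
      rw [integral_sub iΘΨ iΨs', sΨ]
    have J2 : ∫ z, ((Θ z * (max (U z - V z) 0) ^ 2 * (u z - u (z - h • e))
          + 2 * h * (Θ z * (b (z - h • e) * κ (z - h • e))))
          + K.indicator (fun _ : E => h ^ 2 * bm ^ 2 * Cu * A) z)
        = (∫ z, Θ z * (max (U z - V z) 0) ^ 2 * (u z - u (z - h • e)))
          + 2 * h * (∫ z, Θ (z + h • e) * (b z * κ z)) + h ^ 2 * c2 := by
      have i2 := iκs'.const_mul (2 * h)
      have i3 : Integrable (fun z => Θ z * (max (U z - V z) 0) ^ 2 * (u z - u (z - h • e))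
          + 2 * h * (Θ z * (b (z - h • e) * κ (z - h • e)))) volume := iI.add i2
      rw [integral_add i3 iK, integral_add iI i2, integral_const_mul, sκ,
        integral_indicator hK.measurableSet, setIntegral_const, smul_eq_mul]
      rw [hc2]; ring
    have J' : ∫ z, (Θ z * Ψ z - Θ z * Ψ (z - h • e)) ≤ ∫ z, ((Θ z * (max (U z - V z) 0) ^ 2 * (u z - u (z - h • e))
          + 2 * h * (Θ z * (b (z - h • e) * κ (z - h • e))))
          + K.indicator (fun _ : E => h ^ 2 * bm ^ 2 * Cu * A) z) := J
    rw [J1, J2] at J'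
    have J3 : h * (∫ z, θ z * Ψ z) ≤ (∫ z, Θ z * Ψ z) - ∫ z, Θ (z + h • e) * Ψ z := by
      rw [← integral_const_mul, ← integral_sub iΘΨ iΨs]
      refine integral_mono (iθ.const_mul h) (iΘΨ.sub iΨs) fun z => ?_
      show h * (θ z * Ψ z) ≤ Θ z * Ψ z - Θ (z + h • e) * Ψ z
      have := mul_le_mul_of_nonneg_right (hΘs z h hmem) (hΨ0 z)
      linarith
    have J4 : ∫ z, Θ (z + h • e) * (b z * κ z) ≤ ∫ z, Θ z * (b z * κ z) :=
      integral_mono iκs iΘκ fun z =>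
        mul_le_mul_of_nonneg_right (hΘmono z) (mul_nonneg (hb0 z) (hκ0 z))
    have J5 : h * (∫ z, θ z * Ψ z) ≤
        h * (A * (δ * volume.real K + δ) + Fintype.card ι * (A * δ) + δ * c2) := by
      have q1 := mul_le_mul_of_nonneg_left J4 (by positivity : 0 ≤ 2 * h)
      have q2 := mul_nonpos_of_nonneg_of_nonpos hpos.le main0
      have q3 := mul_le_mul_of_nonneg_left (mul_le_mul_of_nonneg_right hhδ hc20) hpos.le
      linarith [q1, q2, q3, hI, J3, J']
    exact le_of_mul_le_mul_left J5 hpos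
  have fin : ∫ z, θ z * Ψ z ≤ 0 := by
    have : Tendsto (fun δ : ℝ => A * (δ * volume.real K + δ) + Fintype.card ι * (A * δ) + δ * c2)
        (𝓝[>] 0) (𝓝 0) := by
      have : Continuous (fun δ : ℝ => A * (δ * volume.real K + δ) + Fintype.card ι * (A * δ) + δ * c2) := by
        fun_prop
      have := this.tendsto 0
      simp only [zero_mul, mul_zero, add_zero] at this
      exact this.mono_left nhdsWithin_le_nhds
    exact ge_of_tendsto this (eventually_nhdsWithin_of_forall fun δ hδ => est δ hδ)
  have hz : ∫ z, θ z * Ψ z = 0 :=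
    le_antisymm fin (integral_nonneg fun z => mul_nonneg (hθ0 z) (hΨ0 z))
  have := (integral_eq_zero_iff_of_nonneg (fun z => mul_nonneg (hθ0 z) (hΨ0 z)) iθ).1 hz
  filter_upwards [this] with z hz hθz
  have h2 : Ψ z = 0 := by
    rcases mul_eq_zero.1 hz with h | h
    · linarith
    · exact h
  rw [hUu]
  exact phi_pos hm (hu0 z) h2.le (hV0 z)
end cmp
end part5

section part6
open Filter Topology
set_option linter.unusedSectionVars false

section conv

lemma setInt_prod {X : Type*} [MeasureSpace X] [SFinite (volume : Measure X)] {T : ℝ}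
    {F : ℝ × X → ℝ} (hF : Integrable F volume)
    (h0 : ∀ s x, s ∉ Ioo (0:ℝ) T → F (s, x) = 0) :
    ∫ s in Ioo (0:ℝ) T, ∫ x, F (s, x) = ∫ z, F z := by
  rw [Measure.volume_eq_prod] at hF ⊢
  rw [integral_prod _ hF, setIntegral_eq_integral_of_forall_compl_eq_zero]
  intro s hs
  simp [h0 s _ hs]

lemma weakSys_of {N : ℕ} {m q : ℝ} (hm : 1 < m) (hq : 0 < q)
    {w : EuclideanSpace ℝ (Fin N) → ℝ} (hw : Continuous w)
    {u0 : EuclideanSpace ℝ (Fin N) → ℝ} (hu0 : IsBddNonneg N u0)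
    {u : ℝ → EuclideanSpace ℝ (Fin N) → ℝ} (hu : IsWeakSolution N m q w u0 u)
    {T : ℝ} (hT : 0 < T) {O : Set (EuclideanSpace ℝ (Fin N))} (hO : IsOpen O)
    (hOb : Bornology.IsBounded O) :
    ∃ g : Fin N → ℝ × EuclideanSpace ℝ (Fin N) → ℝ,
      WeakSys ((1 : ℝ), (0 : EuclideanSpace ℝ (Fin N)))
        (fun i => ((0 : ℝ), EuclideanSpace.single i (1 : ℝ))) (Ioo 0 T ×ˢ O)
        ((Ioo 0 T ×ˢ O).indicator fun z => u z.1 z.2)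
        ((Ioo 0 T ×ˢ O).indicator fun z => u z.1 z.2 ^ m)
        ((Ioo 0 T ×ˢ O).indicator fun z => w z.2 * u z.1 z.2 ^ q) g := by
  obtain ⟨mu, un, ⟨C, uC⟩, g, mg, hg⟩ := hu
  obtain ⟨hgL, hgrad, heqn⟩ := hg T hT
  obtain ⟨mu0, u0n, C0, u0C⟩ := hu0
  set Q : Set (ℝ × EuclideanSpace ℝ (Fin N)) := Ioo 0 T ×ˢ O with hQ
  have mQ : MeasurableSet Q := measurableSet_Ioo.prod hO.measurableSet
  have bQ : Bornology.IsBounded Q := (Metric.isBounded_Ioo 0 T).prod hOb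
  have fQ : volume Q < ⊤ := bQ.measure_lt_top
  have cO : IsCompact (closure O) := hOb.isCompact_closure
  obtain ⟨W, hW⟩ := cO.exists_bound_of_continuousOn hw.continuousOn
  have bd : ∀ (F : ℝ × EuclideanSpace ℝ (Fin N) → ℝ) (B : ℝ), Measurable F →
      (∀ z ∈ Q, ‖F z‖ ≤ B) → MemLp (Q.indicator F) 2 volume := by
    intro F B hF hB
    rw [memLp_indicator_iff_restrict mQ]
    have : IsFiniteMeasure (volume.restrict Q) := ⟨by simpa using fQ⟩
    exact MemLp.of_bound hF.aestronglyMeasurable B (ae_restrict_of_forall_mem mQ hB)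
  have mu' : Measurable fun z : ℝ × EuclideanSpace ℝ (Fin N) => u z.1 z.2 := mu
  have hu2 := bd (fun z => u z.1 z.2) C mu' (fun z _ => by
    rw [Real.norm_of_nonneg (un _ _)]; exact uC _ _)
  have hU2 := bd (fun z => u z.1 z.2 ^ m) (C ^ m) (mu'.pow_const m) (fun z _ => by
    rw [Real.norm_of_nonneg (Real.rpow_nonneg (un _ _) _)]
    exact Real.rpow_le_rpow (un _ _) (uC _ _) (by linarith))
  have hf2 := bd (fun z => w z.2 * u z.1 z.2 ^ q) (W * C ^ q)
    ((hw.measurable.comp measurable_snd).mul (mu'.pow_const q)) (fun z hz => by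
    rw [norm_mul, Real.norm_of_nonneg (Real.rpow_nonneg (un z.1 z.2) _)]
    have h1 := hW z.2 (subset_closure hz.2)
    exact mul_le_mul h1 (Real.rpow_le_rpow (un _ _) (uC _ _) hq.le)
      (Real.rpow_nonneg (un _ _) _) ((norm_nonneg _).trans h1))
  have mg' : ∀ i, Measurable fun z : ℝ × EuclideanSpace ℝ (Fin N) => g z.1 z.2 i := fun i =>
    (by fun_prop : Measurable fun y : EuclideanSpace ℝ (Fin N) => y i).comp mg
  have hg2 : ∀ i, MemLp (Q.indicator fun z => g z.1 z.2 i) 2 volume := by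
    intro i
    rw [memLp_indicator_iff_restrict mQ, memLp_two_iff_integrable_sq (mg' i).aestronglyMeasurable]
    refine ⟨((mg' i).pow_const 2).aestronglyMeasurable, ?_⟩
    rw [hasFiniteIntegral_iff_ofReal (Eventually.of_forall fun z => sq_nonneg _)]
    have mn : Measurable fun z : ℝ × EuclideanSpace ℝ (Fin N) => ENNReal.ofReal (‖g z.1 z.2‖ ^ 2) :=
      ENNReal.measurable_ofReal.comp ((mg.norm).pow_const 2)
    calc ∫⁻ z in Q, ENNReal.ofReal (g z.1 z.2 i ^ 2)
        ≤ ∫⁻ z in Q, ENNReal.ofReal (‖g z.1 z.2‖ ^ 2) := by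
          refine lintegral_mono fun z => ENNReal.ofReal_le_ofReal ?_
          rw [← sq_abs]
          exact pow_le_pow_left₀ (abs_nonneg _) (PiLp.norm_apply_le (g z.1 z.2) i) 2
      _ ≤ ∫⁻ z in Ioo 0 T ×ˢ closure O, ENNReal.ofReal (‖g z.1 z.2‖ ^ 2) :=
          lintegral_mono_set (prod_mono le_rfl subset_closure)
      _ = ∫⁻ s in Ioo (0:ℝ) T, ∫⁻ x in closure O, ENNReal.ofReal (‖g s x‖ ^ 2) := by
          rw [Measure.volume_eq_prod, ← Measure.prod_restrict, lintegral_prod _ mn.aemeasurable]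
      _ < ⊤ := hgL _ cO
  refine ⟨fun i => Q.indicator fun z => g z.1 z.2 i, hu2, hU2, hf2, hg2, ?_, ?_⟩
  · intro ζ hζ L hL hLQ hζ0 i
    have cs : HasCompactSupport ζ := HasCompactSupport.intro hL hζ0
    have ts : ∀ z, z ∉ L → fderiv ℝ ζ z = 0 := by
      intro z hz
      have : ζ =ᶠ[𝓝 z] fun _ => 0 := by
        filter_upwards [hL.isClosed.isOpen_compl.mem_nhds hz] with y hy using hζ0 y hy
      rw [this.fderiv_eq]; simp
    have cd : Continuous (fderiv ℝ ζ) := hζ.continuous_fderiv one_ne_zero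
    have c1 : MemLp (fun z => fderiv ℝ ζ z (0, EuclideanSpace.single i 1)) 2 volume :=
      (cd.clm_apply continuous_const).memLp_of_hasCompactSupport
        (HasCompactSupport.intro hL fun z hz => by rw [ts z hz]; rfl)
    have c2 : MemLp ζ 2 volume := hζ.continuous.memLp_of_hasCompactSupport cs
    have E1 : ∀ z, Q.indicator (fun z => u z.1 z.2 ^ m) z * fderiv ℝ ζ z (0, EuclideanSpace.single i 1)
        = u z.1 z.2 ^ m * fderiv ℝ ζ z (0, EuclideanSpace.single i 1) := by
      intro z
      by_cases hz : z ∈ Q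
      · rw [indicator_of_mem hz]
      · rw [ts z (fun h => hz (hLQ h))]; simp
    have E2 : ∀ z, Q.indicator (fun z => g z.1 z.2 i) z * ζ z = g z.1 z.2 i * ζ z := by
      intro z
      by_cases hz : z ∈ Q
      · rw [indicator_of_mem hz]
      · rw [hζ0 z (fun h => hz (hLQ h))]; simp
    have I1 := hU2.integrable_mul c1
    have I2 := (hg2 i).integrable_mul c2
    have I1' : Integrable (fun z : ℝ × EuclideanSpace ℝ (Fin N) =>
      u z.1 z.2 ^ m * fderiv ℝ ζ z (0, EuclideanSpace.single i 1)) volume :=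
      I1.congr (Eventually.of_forall E1)
    have I2' : Integrable (fun z : ℝ × EuclideanSpace ℝ (Fin N) => g z.1 z.2 i * ζ z) volume :=
      I2.congr (Eventually.of_forall E2)
    have nL : ∀ s x, s ∉ Ioo (0:ℝ) T → (s, x) ∉ L := fun s x hs h => hs (hLQ h).1
    have := hgrad ζ hζ cs (fun s x hs => hζ0 _ (nL s x hs)) i
    rw [integral_congr_ae (Eventually.of_forall E1), integral_congr_ae (Eventually.of_forall E2)]
    rw [← setInt_prod I1' (T := T) (fun s x hs => by rw [ts _ (nL s x hs)]; simp),
      ← setInt_prod I2' (T := T) (fun s x hs => by rw [hζ0 _ (nL s x hs)]; simp)]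
    exact this
  · intro ζ hζ L hL hLQ hζ0
    have cs : HasCompactSupport ζ := HasCompactSupport.intro hL hζ0
    have ts : ∀ z, z ∉ L → fderiv ℝ ζ z = 0 := by
      intro z hz
      have : ζ =ᶠ[𝓝 z] fun _ => 0 := by
        filter_upwards [hL.isClosed.isOpen_compl.mem_nhds hz] with y hy using hζ0 y hy
      rw [this.fderiv_eq]; simp
    have cd : Continuous (fderiv ℝ ζ) := hζ.continuous_fderiv one_ne_zero
    have csv : ∀ v, HasCompactSupport fun z => fderiv ℝ ζ z v := fun v =>
      HasCompactSupport.intro hL fun z hz => by rw [ts z hz]; rfl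
    have c1 : ∀ v, MemLp (fun z => fderiv ℝ ζ z v) 2 volume := fun v =>
      (cd.clm_apply continuous_const).memLp_of_hasCompactSupport (csv v)
    have c2 : MemLp ζ 2 volume := hζ.continuous.memLp_of_hasCompactSupport cs
    have E1 : ∀ (F : ℝ × EuclideanSpace ℝ (Fin N) → ℝ) v z, Q.indicator F z * fderiv ℝ ζ z v
        = F z * fderiv ℝ ζ z v := by
      intro F v z
      by_cases hz : z ∈ Q
      · rw [indicator_of_mem hz]
      · rw [ts z (fun h => hz (hLQ h))]; simp
    have E2 : ∀ (F : ℝ × EuclideanSpace ℝ (Fin N) → ℝ) z, Q.indicator F z * ζ z = F z * ζ z := by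
      intro F z
      by_cases hz : z ∈ Q
      · rw [indicator_of_mem hz]
      · rw [hζ0 z (fun h => hz (hLQ h))]; simp
    have nL : ∀ s x, s ∉ Ioo (0:ℝ) T → (s, x) ∉ L := fun s x hs h => hs (hLQ h).1
    have I1 : Integrable (fun z => Q.indicator (fun z => u z.1 z.2) z * fderiv ℝ ζ z (1, 0)) volume :=
      hu2.integrable_mul (c1 _)
    have I2 : ∀ i, Integrable (fun z => Q.indicator (fun z => g z.1 z.2 i) z *
      fderiv ℝ ζ z (0, EuclideanSpace.single i 1)) volume :=
      fun i => (hg2 i).integrable_mul (c1 _)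
    have I3 : Integrable (fun z => Q.indicator (fun z => w z.2 * u z.1 z.2 ^ q) z * ζ z) volume :=
      hf2.integrable_mul c2
    have I0 : Integrable (fun z : ℝ × EuclideanSpace ℝ (Fin N) => u0 z.2 * fderiv ℝ ζ z (1, 0)) volume := by
      refine Integrable.bdd_mul (c := C0) ?_ (mu0.comp measurable_snd).aestronglyMeasurable
        (Eventually.of_forall fun z => ?_)
      · exact (cd.clm_apply continuous_const).integrable_of_hasCompactSupport (csv _)
      · rw [Real.norm_of_nonneg (u0n _)]; exact u0C _
    have Z0 : ∫ z : ℝ × EuclideanSpace ℝ (Fin N), u0 z.2 * fderiv ℝ ζ z (1, 0) = 0 := by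
      rw [Measure.volume_eq_prod] at I0 ⊢
      rw [integral_prod_symm _ I0]
      have : ∀ x, ∫ s, u0 x * fderiv ℝ ζ (s, x) (1, 0) = 0 := by
        intro x
        rw [integral_const_mul]
        have hc : Continuous fun s : ℝ => (s, x) := by fun_prop
        have hL1 : IsCompact (Prod.fst '' L) := hL.image continuous_fst
        have z1 : HasCompactSupport fun s => ζ (s, x) := HasCompactSupport.intro hL1
          fun s hs => hζ0 _ fun h => hs ⟨_, h, rfl⟩
        have z2 : HasCompactSupport fun s => fderiv ℝ ζ (s, x) (1, 0) := HasCompactSupport.intro hL1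
          fun s hs => by rw [ts _ fun h => hs ⟨_, h, rfl⟩]; rfl
        have hd : ∀ s, HasDerivAt (fun s => ζ (s, x)) (fderiv ℝ ζ (s, x) (1, 0)) s := by
          intro s
          have h1 := (hζ.differentiable one_ne_zero (s, x)).hasFDerivAt
          have h2 : HasDerivAt (fun s : ℝ => (s, x)) (1, 0) s :=
            (hasDerivAt_id s).prodMk (hasDerivAt_const s x)
          exact h1.comp_hasDerivAt s h2
        have hi : Integrable fun s => fderiv ℝ ζ (s, x) (1, 0) :=
          ((cd.comp hc).clm_apply continuous_const).integrable_of_hasCompactSupport z2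
        have hcc : Tendsto (fun s => ζ (s, x)) (cocompact ℝ) (𝓝 0) := by
          have : (fun s => ζ (s, x)) =ᶠ[cocompact ℝ] fun _ => 0 := by
            have := hasCompactSupport_iff_eventuallyEq.1 z1
            rw [coclosedCompact_eq_cocompact] at this
            exact this
          exact (tendsto_congr' this).2 tendsto_const_nhds
        have := integral_of_hasDerivAt_of_tendsto hd hi
          (hcc.mono_left atBot_le_cocompact) (hcc.mono_left atTop_le_cocompact)
        rw [this]; simp
      simp [this]
    have H := heqn ζ hζ cs (fun s x hs => hζ0 _ (nL s x (fun h => absurd h.2 (not_lt.2 hs))))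
    have lin : ∀ z : ℝ × EuclideanSpace ℝ (Fin N), fderiv ℝ ζ z (0, g z.1 z.2) =
        ∑ i, g z.1 z.2 i * fderiv ℝ ζ z (0, EuclideanSpace.single i 1) := by
      intro z
      have : ((0 : ℝ), g z.1 z.2) = ∑ i, g z.1 z.2 i • ((0 : ℝ), EuclideanSpace.single i (1:ℝ)) := by
        refine Prod.ext ?_ ?_
        · simp [Prod.fst_sum]
        · ext j
          simp [Prod.snd_sum, Finset.sum_apply, Pi.single_apply]
      rw [this, map_sum]
      simp [-Prod.smul_mk]
    have EQ : ∀ z : ℝ × EuclideanSpace ℝ (Fin N),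
        (u0 z.2 * fderiv ℝ ζ z (1, 0) - Q.indicator (fun z => u z.1 z.2) z * fderiv ℝ ζ z (1, 0))
        + (∑ i, Q.indicator (fun z => g z.1 z.2 i) z * fderiv ℝ ζ z (0, EuclideanSpace.single i 1))
        + Q.indicator (fun z => w z.2 * u z.1 z.2 ^ q) z * ζ z
        = (u0 z.2 - u z.1 z.2) * fderiv ℝ ζ z (1, 0) + fderiv ℝ ζ z (0, g z.1 z.2)
          + w z.2 * (u z.1 z.2) ^ q * ζ z := by
      intro z
      rw [E1, E2, lin, Finset.sum_congr rfl (fun i _ => E1 (fun z => g z.1 z.2 i) _ z)]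
      ring
    have IS : Integrable (fun z => ∑ i, Q.indicator (fun z => g z.1 z.2 i) z *
      fderiv ℝ ζ z (0, EuclideanSpace.single i 1)) volume := integrable_finsetSum _ fun i _ => I2 i
    have I01 : Integrable (fun z : ℝ × EuclideanSpace ℝ (Fin N) => u0 z.2 * fderiv ℝ ζ z (1, 0) -
      Q.indicator (fun z => u z.1 z.2) z * fderiv ℝ ζ z (1, 0)) volume := I0.sub I1
    have I012 : Integrable (fun z : ℝ × EuclideanSpace ℝ (Fin N) => (u0 z.2 * fderiv ℝ ζ z (1, 0) -
      Q.indicator (fun z => u z.1 z.2) z * fderiv ℝ ζ z (1, 0)) +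
      (∑ i, Q.indicator (fun z => g z.1 z.2 i) z *
      fderiv ℝ ζ z (0, EuclideanSpace.single i 1))) volume := I01.add IS
    have TOT : ∫ z : ℝ × EuclideanSpace ℝ (Fin N),
        ((u0 z.2 * fderiv ℝ ζ z (1, 0) - Q.indicator (fun z => u z.1 z.2) z * fderiv ℝ ζ z (1, 0))
        + (∑ i, Q.indicator (fun z => g z.1 z.2 i) z * fderiv ℝ ζ z (0, EuclideanSpace.single i 1))
        + Q.indicator (fun z => w z.2 * u z.1 z.2 ^ q) z * ζ z) = 0 := by
      have I0123 : Integrable (fun z : ℝ × EuclideanSpace ℝ (Fin N) =>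
        (u0 z.2 * fderiv ℝ ζ z (1, 0) - Q.indicator (fun z => u z.1 z.2) z * fderiv ℝ ζ z (1, 0))
        + (∑ i, Q.indicator (fun z => g z.1 z.2 i) z * fderiv ℝ ζ z (0, EuclideanSpace.single i 1))
        + Q.indicator (fun z => w z.2 * u z.1 z.2 ^ q) z * ζ z) volume := I012.add I3
      rw [← setInt_prod I0123 (T := T) (fun s x hs => by
        simp [ts _ (nL s x hs), hζ0 _ (nL s x hs)])]
      refine Eq.trans ?_ H
      refine setIntegral_congr_fun measurableSet_Ioo fun s _ => ?_
      exact integral_congr_ae (Eventually.of_forall fun x => EQ (s, x))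
    rw [integral_add I012 I3, integral_add I01 IS, integral_sub I0 I1, Z0,
      integral_finsetSum _ (fun i _ => I2 i)] at TOT
    linarith
end conv
end part6

section part7
open Filter Topology
set_option linter.unusedSectionVars false

section barrier

lemma pow_conv (n : ℕ) {a b : ℝ} (hb : 0 ≤ b) (hab : b ≤ a) :
    a ^ (n + 1) - b ^ (n + 1) ≤ (n + 1) * a ^ n * (a - b) := by
  induction n with
  | zero => simp
  | succ n ih =>
    have ha : 0 ≤ a := hb.trans hab
    have h1 := mul_le_mul_of_nonneg_left ih ha
    have h2 := mul_le_mul_of_nonneg_right (pow_le_pow_left₀ hb hab (n + 1)) (sub_nonneg.2 hab)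
    push_cast
    have e1 : a ^ (n + 1 + 1) - b ^ (n + 1 + 1) =
      a * (a ^ (n + 1) - b ^ (n + 1)) + b ^ (n + 1) * (a - b) := by ring
    have e2 : ((n : ℝ) + 1 + 1) * a ^ (n + 1) * (a - b) =
      a * ((n + 1) * a ^ n * (a - b)) + a ^ (n + 1) * (a - b) := by ring
    linarith

lemma main_scalar {N k : ℕ} {m q τ : ℝ} (hm : 1 < m) (hq0 : 0 < q) (hq1 : q < 1) (hτ : 0 < τ)
    (hk : m / (1 - q) ≤ k + 2) {u ρ D B L wx : ℝ} (hu : 0 ≤ u) (hρ0 : 0 ≤ ρ) (hρ1 : ρ ≤ 1)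
    (hD : 1 ≤ D) (hB : 1 ≤ B) {z : Fin N → ℝ} (hz : ∀ i, |z i| ≤ 1)
    (hL1 : 4 * (D * (k + 2) / τ) ≤ L) (hL2 : 2 * (B * (2 * k + 4) * (2 * k + 3) * N) ≤ L)
    (hwx : L ≤ wx) {V : ℝ} (hV : V = D * ρ ^ (k + 2) + B * ∑ i, z i ^ (2 * k + 4))
    (hVu : V < u ^ m) :
    (max (u ^ m - V) 0) ^ 2 * (∑ i, B * (2 * k + 4) * (2 * k + 3) * z i ^ (2 * k + 2) - wx * u ^ q)
      + 2 * (D * (k + 2) / τ * ρ ^ (k + 1) * Kap m V u) ≤ 0 := by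
  have hm0 : 0 < m := by linarith
  have hq1' : 0 < 1 - q := by linarith
  have hkk : m ≤ (k + 2) * (1 - q) := by rwa [div_le_iff₀ hq1'] at hk
  have hk0 : (0 : ℝ) ≤ k := Nat.cast_nonneg k
  have hzn : ∀ i, 0 ≤ z i ^ (2 * k + 4) := fun i => Even.pow_nonneg ⟨k + 2, by ring⟩ _
  have hP0 : 0 ≤ B * ∑ i, z i ^ (2 * k + 4) := mul_nonneg (by linarith) (Finset.sum_nonneg fun i _ => hzn i)
  have ha0 : 0 ≤ D * ρ ^ (k + 2) := by positivity
  have hV0 : 0 ≤ V := by rw [hV]; linarith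
  have hL0 : 0 ≤ L := le_trans (by positivity) hL1
  have huV : V ^ (q / m) ≤ u ^ q := by
    have := Real.rpow_le_rpow hV0 hVu.le (by positivity : 0 ≤ q / m)
    rwa [← Real.rpow_mul hu, mul_div_cancel₀ _ hm0.ne'] at this
  have huq0 : 0 ≤ u ^ q := by positivity
  set f := wx * u ^ q with hf
  have hfL : L * u ^ q ≤ f := mul_le_mul_of_nonneg_right hwx huq0
  have hf0 : 0 ≤ f := le_trans (by positivity) hfL
  -- laplacian
  have hzi : ∀ i, z i ^ (2 * k + 2) ≤ u ^ q := by
    intro i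
    refine le_trans ?_ huV
    have h1 : z i ^ (2 * k + 4) ≤ V := by
      have a1 := Finset.single_le_sum (f := fun i => z i ^ (2 * k + 4)) (fun i _ => hzn i) (Finset.mem_univ i)
      have a2 : ∑ i, z i ^ (2 * k + 4) ≤ B * ∑ i, z i ^ (2 * k + 4) :=
        le_mul_of_one_le_left (Finset.sum_nonneg fun i _ => hzn i) hB
      have a3 : z i ^ (2 * k + 4) ≤ ∑ i, z i ^ (2 * k + 4) := a1
      rw [hV]; linarith
    refine le_trans ?_ (Real.rpow_le_rpow (hzn i) h1 (by positivity))
    have e1 : z i ^ (2 * k + 2) = |z i| ^ (2 * k + 2) := (Even.pow_abs ⟨k + 1, by ring⟩ _).symm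
    have e2 : z i ^ (2 * k + 4) = |z i| ^ (2 * k + 4) := (Even.pow_abs ⟨k + 2, by ring⟩ _).symm
    rw [e1, e2, ← Real.rpow_natCast, ← Real.rpow_natCast, ← Real.rpow_mul (abs_nonneg _)]
    refine Real.rpow_le_rpow_of_exponent_ge' (abs_nonneg _) (hz i) (by positivity) ?_
    push_cast
    rw [mul_div_assoc', div_le_iff₀ hm0]
    nlinarith [mul_nonneg hk0 (by linarith : (0:ℝ) ≤ m - 1)]
  have hlap : 2 * ∑ i, B * (2 * k + 4) * (2 * k + 3) * z i ^ (2 * k + 2) ≤ f := by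
    have : ∑ i, B * (2 * k + 4) * (2 * k + 3) * z i ^ (2 * k + 2) ≤
        ∑ i : Fin N, B * (2 * k + 4) * (2 * k + 3) * u ^ q :=
      Finset.sum_le_sum fun i _ => mul_le_mul_of_nonneg_left (hzi i) (by positivity)
    rw [Finset.sum_const, Finset.card_univ, Fintype.card_fin, nsmul_eq_mul] at this
    have h2 := mul_le_mul_of_nonneg_right hL2 huq0
    nlinarith
  -- time part
  set y2 := (max (u ^ m - V) 0) ^ 2 with hy2
  have hy0 : 0 ≤ y2 := sq_nonneg _
  have hK0 := kap_nonneg (m := m) V hu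
  have hkp := kap_p2 hm hV0 hu
  have ht : 4 * (D * (k + 2) / τ * ρ ^ (k + 1)) ≤ f * V ^ ((m - 1) / m) := by
    have h1 : ρ ^ (k + 1) ≤ V ^ (q / m) * V ^ ((m - 1) / m) := by
      have haV : ρ ^ (k + 2) ≤ V := by
        have : ρ ^ (k + 2) ≤ D * ρ ^ (k + 2) := le_mul_of_one_le_left (by positivity) hD
        rw [hV]; linarith
      rw [← Real.rpow_add_of_nonneg hV0 (by positivity) (div_nonneg (by linarith) hm0.le)]
      refine le_trans ?_ (Real.rpow_le_rpow (by positivity) haV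
        (add_nonneg (by positivity) (div_nonneg (by linarith) hm0.le)))
      rw [← Real.rpow_natCast, ← Real.rpow_natCast, ← Real.rpow_mul hρ0]
      refine Real.rpow_le_rpow_of_exponent_ge' hρ0 hρ1 ?_ ?_
      · exact mul_nonneg (by positivity) (add_nonneg (by positivity) (div_nonneg (by linarith) hm0.le))
      · push_cast
        rw [← add_div, mul_div_assoc', div_le_iff₀ hm0]
        nlinarith
    have hVm : 0 ≤ V ^ ((m - 1) / m) := by positivity
    calc 4 * (D * (k + 2) / τ * ρ ^ (k + 1)) = 4 * (D * (k + 2) / τ) * ρ ^ (k + 1) := by ring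
      _ ≤ L * (V ^ (q / m) * V ^ ((m - 1) / m)) := mul_le_mul hL1 h1 (by positivity) hL0
      _ ≤ L * (u ^ q * V ^ ((m - 1) / m)) := by gcongr
      _ = L * u ^ q * V ^ ((m - 1) / m) := by ring
      _ ≤ f * V ^ ((m - 1) / m) := mul_le_mul_of_nonneg_right hfL hVm
  have t1 := mul_le_mul_of_nonneg_right ht hK0
  have t2 := mul_le_mul_of_nonneg_left hkp hf0
  have t3 := mul_le_mul_of_nonneg_left hlap hy0
  nlinarith [t1, t2, t3]
end barrier
end part7

section part8
open Filter Topology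
set_option linter.unusedSectionVars false

section fin
variable {N : ℕ}

instance haarE : (volume : Measure (ℝ × EuclideanSpace ℝ (Fin N))).IsAddHaarMeasure := by
  rw [Measure.volume_eq_prod]
  infer_instance

/-- the coordinate functional -/
def crd (i : Fin N) : (ℝ × EuclideanSpace ℝ (Fin N)) →L[ℝ] ℝ :=
  (EuclideanSpace.proj i).comp (ContinuousLinearMap.snd ℝ ℝ (EuclideanSpace ℝ (Fin N)))

lemma crd_apply (i : Fin N) (z : ℝ × EuclideanSpace ℝ (Fin N)) : crd i z = z.2 i := rfl

lemma crd_single (i j : Fin N) : crd j ((0 : ℝ), EuclideanSpace.single i (1:ℝ)) = if j = i then 1 else 0 := by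
  rw [crd_apply]; simp

def Vb (k : ℕ) (D B τ : ℝ) (x0 : EuclideanSpace ℝ (Fin N)) (z : ℝ × EuclideanSpace ℝ (Fin N)) : ℝ :=
  D * (max (1 - z.1 / τ) 0) ^ (k + 2) + B * ∑ i, (z.2 i - x0 i) ^ (2 * k + 4)

lemma cd_crd (i : Fin N) : ContDiff ℝ 1 (fun z : ℝ × EuclideanSpace ℝ (Fin N) => z.2 i) :=
  (crd i).contDiff

lemma Vb_contDiff (k : ℕ) (D B τ : ℝ) (x0 : EuclideanSpace ℝ (Fin N)) : ContDiff ℝ 1 (Vb k D B τ x0) := by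
  unfold Vb
  refine (contDiff_const.mul ((contDiff_pp k).comp (contDiff_const.sub (contDiff_fst.div_const τ)))).add
    (contDiff_const.mul (ContDiff.sum fun i _ => ((cd_crd i).sub contDiff_const).pow _))

lemma hfd_pow (i : Fin N) (c : ℝ) (n : ℕ) (z : ℝ × EuclideanSpace ℝ (Fin N)) :
    HasFDerivAt (fun z : ℝ × EuclideanSpace ℝ (Fin N) => (z.2 i - c) ^ (n + 1))
      ((((n : ℝ) + 1) * (z.2 i - c) ^ n) • crd i) z := by
  have h1 : HasFDerivAt (fun z : ℝ × EuclideanSpace ℝ (Fin N) => z.2 i - c) (crd i) z :=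
    (crd i).hasFDerivAt.sub_const c
  have h2 : HasDerivAt (fun y : ℝ => y ^ (n + 1)) (((n : ℝ) + 1) * (z.2 i - c) ^ n) (z.2 i - c) := by
    have := hasDerivAt_pow (n + 1) (z.2 i - c)
    simpa using this
  exact h2.comp_hasFDerivAt z h1

lemma Vb_fderiv (k : ℕ) (D B τ : ℝ) (x0 : EuclideanSpace ℝ (Fin N))
    (z : ℝ × EuclideanSpace ℝ (Fin N)) (i : Fin N) :
    fderiv ℝ (Vb k D B τ x0) z ((0 : ℝ), EuclideanSpace.single i (1:ℝ)) =
      B * (2 * k + 4) * (z.2 i - x0 i) ^ (2 * k + 3) := by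
  have h1 : HasFDerivAt (fun z : ℝ × EuclideanSpace ℝ (Fin N) => 1 - z.1 / τ)
      (-(τ⁻¹ • ContinuousLinearMap.fst ℝ ℝ (EuclideanSpace ℝ (Fin N)))) z := by
    have := ((ContinuousLinearMap.fst ℝ ℝ (EuclideanSpace ℝ (Fin N))).hasFDerivAt (x := z)).const_mul τ⁻¹
    have := this.const_sub 1
    simpa [div_eq_inv_mul] using this
  have h2 := ((hasDerivAt_pp k (1 - z.1 / τ)).comp_hasFDerivAt z h1).const_mul D
  have h3 := (HasFDerivAt.fun_sum (u := Finset.univ) fun i _ => hfd_pow i (x0 i) (2 * k + 3) z).const_mul B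
  have h4 : HasFDerivAt (Vb k D B τ x0) _ z := h2.add h3
  rw [h4.fderiv]
  simp only [add_apply, smul_apply, sum_apply,
    neg_apply, crd_single, ContinuousLinearMap.coe_fst', smul_eq_mul, mul_ite, mul_one, mul_zero]
  simp
  ring

lemma p_fderiv (k : ℕ) (B c : ℝ) (z : ℝ × EuclideanSpace ℝ (Fin N)) (i : Fin N) :
    fderiv ℝ (fun z : ℝ × EuclideanSpace ℝ (Fin N) => B * (2 * k + 4) * (z.2 i - c) ^ (2 * k + 3)) z
      ((0 : ℝ), EuclideanSpace.single i (1:ℝ)) = B * (2 * k + 4) * (2 * k + 3) * (z.2 i - c) ^ (2 * k + 2) := by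
  have h3 := (hfd_pow i c (2 * k + 2) z).const_mul (B * (2 * k + 4))
  rw [h3.fderiv]
  simp only [smul_apply, crd_single, smul_eq_mul]
  push_cast
  simp
  ring

lemma Th_fderiv (T : ℝ) (z : ℝ × EuclideanSpace ℝ (Fin N)) (v : EuclideanSpace ℝ (Fin N)) :
    fderiv ℝ (fun z : ℝ × EuclideanSpace ℝ (Fin N) => (max (T - z.1) 0) ^ 2) z ((0 : ℝ), v) = 0 := by
  have h1 : HasFDerivAt (fun z : ℝ × EuclideanSpace ℝ (Fin N) => T - z.1)
      (-(ContinuousLinearMap.fst ℝ ℝ (EuclideanSpace ℝ (Fin N)))) z :=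
    ((ContinuousLinearMap.fst ℝ ℝ (EuclideanSpace ℝ (Fin N))).hasFDerivAt (x := z)).const_sub T
  have h2 := (hasDerivAt_pp 0 (T - z.1)).comp_hasFDerivAt z h1
  have h3 : HasFDerivAt (fun z : ℝ × EuclideanSpace ℝ (Fin N) => (max (T - z.1) 0) ^ 2) _ z := h2
  rw [h3.fderiv]
  simp

lemma norm_cube {x y : EuclideanSpace ℝ (Fin N)} (h : ∀ i, |x i - y i| ≤ 1) : ‖x - y‖ ≤ N := by
  have h1 : ‖x - y‖ ^ 2 ≤ N := by
    rw [EuclideanSpace.norm_sq_eq]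
    calc ∑ i, ‖(x - y) i‖ ^ 2 ≤ ∑ i : Fin N, (1:ℝ) := Finset.sum_le_sum fun i _ => by
          have := h i
          rw [← Real.norm_eq_abs] at this
          exact pow_le_one₀ (norm_nonneg _) this
      _ = N := by simp
  rcases Nat.eq_zero_or_pos N with h0 | h0
  · subst h0
    have : ‖x - y‖ ^ 2 = 0 := le_antisymm (by simpa using h1) (sq_nonneg _)
    rw [pow_eq_zero_iff two_ne_zero] at this
    simp [this]
  · have : (1:ℝ) ≤ N := by exact_mod_cast h0
    nlinarith [norm_nonneg (x - y)]

lemma barrier_bound {m q σ : ℝ} (hm : 1 < m) (hq0 : 0 < q) (hq1 : q < 1)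
    (hσ0 : 0 < σ)
    {u0 : EuclideanSpace ℝ (Fin N) → ℝ} (hu0 : IsBddNonneg N u0)
    {u : ℝ → EuclideanSpace ℝ (Fin N) → ℝ}
    (hu : IsWeakSolution N m q (fun x => ‖x‖ ^ σ) u0 u) {τ : ℝ} (hτ : 0 < τ) :
    ∃ R0 : ℝ, 0 < R0 ∧ ∃ B : ℝ, 0 ≤ B ∧ ∃ k : ℕ, ∀ x0 : EuclideanSpace ℝ (Fin N), R0 ≤ ‖x0‖ →
      ∀ T : ℝ, 0 < T → ∀ᵐ z : ℝ × EuclideanSpace ℝ (Fin N), τ ≤ z.1 → z.1 < T - 1 →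
        (∀ i, |z.2 i - x0 i| < 2) → u z.1 z.2 ^ m ≤ B * ∑ i, (z.2 i - x0 i) ^ (2 * k + 4) := by
  obtain ⟨C, uC⟩ := hu.2.2.1
  have un := hu.2.1
  have hC : 0 ≤ C := (un 0 0).trans (uC 0 0)
  have hm0 : 0 < m := by linarith
  obtain ⟨k, hk⟩ := exists_nat_ge (m / (1 - q))
  have hk2 : m / (1 - q) ≤ k + 2 := by linarith
  set M := C ^ m with hM
  have hM0 : 0 ≤ M := by positivity
  set B := M + 1 with hB
  set D := 2 ^ (k + 2) * (M + 1) with hD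
  have h2k : (1:ℝ) ≤ 2 ^ (k + 2) := one_le_pow₀ one_le_two
  have hD1 : 1 ≤ D := by nlinarith
  have hB1 : 1 ≤ B := by linarith
  set L := max (4 * (D * (k + 2) / τ)) (2 * (B * (2 * k + 4) * (2 * k + 3) * N)) with hL
  have hL0 : 0 ≤ L := le_trans (by positivity) (le_max_left _ _)
  refine ⟨L ^ (1 / σ) + N + 1, by positivity, B, by linarith, k, fun x0 hx0 T hT => ?_⟩
  have hw : Continuous fun x : EuclideanSpace ℝ (Fin N) => ‖x‖ ^ σ :=
    (Real.continuous_rpow_const hσ0.le).comp continuous_norm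
  -- the domain
  set O : Set (EuclideanSpace ℝ (Fin N)) := {x | ∀ i, |x i - x0 i| < 2} with hO
  have ci : ∀ i : Fin N, Continuous fun x : EuclideanSpace ℝ (Fin N) => x i := fun i => by fun_prop
  have oO : IsOpen O := by
    rw [hO, ofPred_forall]
    exact isOpen_iInter_of_finite fun i =>
      isOpen_lt (((ci i).sub continuous_const).abs) continuous_const
  have cubeb : ∀ r : ℝ, 0 ≤ r → Bornology.IsBounded {x : EuclideanSpace ℝ (Fin N) | ∀ i, |x i - x0 i| ≤ r} := by
    intro r hr
    refine (Metric.isBounded_closedBall (x := x0) (r := Real.sqrt (N * r ^ 2))).subset fun x hx => ?_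
    rw [Metric.mem_closedBall, dist_eq_norm]
    apply Real.le_sqrt_of_sq_le
    rw [EuclideanSpace.norm_sq_eq]
    calc ∑ i, ‖(x - x0) i‖ ^ 2 ≤ ∑ i : Fin N, r ^ 2 := Finset.sum_le_sum fun i _ => by
          have := hx i
          rw [← Real.norm_eq_abs] at this
          exact pow_le_pow_left₀ (norm_nonneg _) this 2
      _ = N * r ^ 2 := by simp
  have bO : Bornology.IsBounded O := (cubeb 2 (by norm_num)).subset fun x hx i => (hx i).le
  obtain ⟨g, hS⟩ := weakSys_of hm hq0 hw hu0 hu (T := T + 1) (by linarith) oO bO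
  set Q : Set (ℝ × EuclideanSpace ℝ (Fin N)) := Ioo 0 (T + 1) ×ˢ O with hQ
  set K : Set (ℝ × EuclideanSpace ℝ (Fin N)) := Icc (τ / 2) T ×ˢ {x | ∀ i, |x i - x0 i| ≤ 1} with hK
  have cK : IsCompact K := by
    refine isCompact_Icc.prod (Metric.isCompact_of_isClosed_isBounded ?_ (cubeb 1 zero_le_one))
    rw [ofPred_forall]
    exact isClosed_iInter fun i => isClosed_le (((ci i).sub continuous_const).abs) continuous_const
  have KQ : ∀ z ∈ K, z ∈ Q := fun z hz =>
    ⟨⟨by linarith [hz.1.1], by linarith [hz.1.2]⟩, fun i => lt_of_le_of_lt (hz.2 i) (by norm_num)⟩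
  set h1 := min (τ / 4) 1 with hh1
  have hh : 0 < h1 := lt_min (by linarith) one_pos
  have hhτ : h1 ≤ τ / 4 := min_le_left _ _
  have hh1' : h1 ≤ 1 := min_le_right _ _
  have f1 : ∀ (z : ℝ × EuclideanSpace ℝ (Fin N)) (r : ℝ),
      (z - r • ((1 : ℝ), (0 : EuclideanSpace ℝ (Fin N)))).1 = z.1 - r := fun z r => by simp
  have f2 : ∀ (z : ℝ × EuclideanSpace ℝ (Fin N)) (r : ℝ),
      (z - r • ((1 : ℝ), (0 : EuclideanSpace ℝ (Fin N)))).2 = z.2 := fun z r => by simp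
  have f3 : ∀ (z : ℝ × EuclideanSpace ℝ (Fin N)) (r : ℝ),
      (z + r • ((1 : ℝ), (0 : EuclideanSpace ℝ (Fin N)))).1 = z.1 + r := fun z r => by simp
  have hsum0 : ∀ z : ℝ × EuclideanSpace ℝ (Fin N), 0 ≤ ∑ i, (z.2 i - x0 i) ^ (2 * k + 4) := fun z =>
    Finset.sum_nonneg fun i _ => Even.pow_nonneg ⟨k + 2, by ring⟩ _
  have hmx0 : ∀ y : ℝ, 0 ≤ max y 0 := fun y => le_max_right _ _
  obtain ⟨W, hW⟩ := (bO.isCompact_closure).exists_bound_of_continuousOn hw.continuousOn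
  have hlip : ∀ (z : ℝ × EuclideanSpace ℝ (Fin N)) (r : ℝ), 0 ≤ r →
      max (1 - z.1 / τ) 0 ≤ max (1 - (z.1 - r) / τ) 0 ∧
      max (1 - (z.1 - r) / τ) 0 - max (1 - z.1 / τ) 0 ≤ r / τ := by
    intro z r hr
    have e : 1 - (z.1 - r) / τ = 1 - z.1 / τ + r / τ := by ring
    have p : 0 ≤ r / τ := by positivity
    rw [e]
    refine ⟨max_le_max (by linarith) le_rfl, ?_⟩
    have a1 := le_max_left (1 - z.1 / τ) 0
    have a2 := hmx0 (1 - z.1 / τ)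
    have : max (1 - z.1 / τ + r / τ) 0 ≤ max (1 - z.1 / τ) 0 + r / τ := max_le (by linarith) (by linarith)
    linarith
  have cmp := comparison (Q := Q) (K := K) hm hS (V := Vb k D B τ x0)
    (Θ := fun z => (max (T - z.1) 0) ^ 2)
    (θ := fun z => max (T - 1 - z.1) 0) (b := fun z => D * (k + 2) / τ * (max (1 - z.1 / τ) 0) ^ (k + 1))
    (p := fun i z => B * (2 * k + 4) * (z.2 i - x0 i) ^ (2 * k + 3)) (h1 := h1)
    (bm := D * (k + 2) / τ) (ε := min (τ / 8) (1 / 2)) (M := M) (Cu := C) (Cf := max W 0 * C ^ q)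
    (hUu := by
      intro z
      by_cases hz : z ∈ Q
      · rw [indicator_of_mem hz, indicator_of_mem hz]
      · rw [indicator_of_notMem hz, indicator_of_notMem hz, Real.zero_rpow hm0.ne'])
    (hV := Vb_contDiff k D B τ x0)
    (hΘ := (contDiff_pp 0).comp (contDiff_const.sub contDiff_fst))
    (hb := by fun_prop)
    (hθ := by fun_prop)
    (hp := fun i => contDiff_const.mul (((cd_crd i).sub contDiff_const).pow _))
    (hK := cK) (hh := hh) (hΘ0 := fun z => sq_nonneg _) (hθ0 := fun z => hmx0 _)
    (hV0 := fun z => by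
      have := hsum0 z
      have := hmx0 (1 - z.1 / τ)
      unfold Vb
      positivity)
    (hb0 := fun z => by
      have := hmx0 (1 - z.1 / τ)
      positivity)
    (hbm0 := by positivity)
    (hbm := by
      intro z hz r hr
      have hz1 := hz.1.1
      have hr2 := hr.2
      rw [f1]
      have : max (1 - (z.1 - r) / τ) 0 ≤ 1 := by
        refine max_le ?_ zero_le_one
        have : 0 ≤ (z.1 - r) / τ := div_nonneg (by linarith) hτ.le
        linarith
      have h3 : (max (1 - (z.1 - r) / τ) 0) ^ (k + 1) ≤ 1 := pow_le_one₀ (hmx0 _) this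
      exact mul_le_of_le_one_right (by positivity) h3)
    (hΘd := fun z i => Th_fderiv T z _)
    (hVp := fun z i => Vb_fderiv k D B τ x0 z i)
    (hε := lt_min (by linarith) (by norm_num))
    (hKQ := by
      intro z hz r hr y hy
      have hz1 := hz.1.1
      have hz2 := hz.1.2
      have hr1 := hr.1
      have hr2 := hr.2
      rw [Metric.mem_closedBall, Prod.dist_eq, f1, f2] at hy
      have d1 := ((le_max_left _ _).trans hy).trans (min_le_left _ _)
      have d1' := ((le_max_left _ _).trans hy).trans (min_le_right _ _)
      have d2 := ((le_max_right _ _).trans hy).trans (min_le_right _ _)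
      rw [Real.dist_eq, abs_le] at d1 d1'
      refine ⟨⟨by linarith, by linarith⟩, fun i => ?_⟩
      have d3 : |y.2 i - z.2 i| ≤ 1 / 2 := by
        have := PiLp.norm_apply_le (y.2 - z.2) i
        rw [dist_eq_norm] at d2
        exact this.trans d2
      have d4 := hz.2 i
      rw [abs_le] at d3 d4
      rw [abs_lt]
      constructor <;> linarith)
    (hu0 := fun z => indicator_nonneg (fun z _ => un _ _) z)
    (huC := fun z => by
      refine indicator_apply_le' (fun _ => uC _ _) fun _ => hC)
    (hUM := fun z => by
      refine indicator_apply_le' (fun _ => Real.rpow_le_rpow (un _ _) (uC _ _) hm0.le) fun _ => hM0)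
    (hf0 := fun z => indicator_nonneg (fun z _ =>
      mul_nonneg (Real.rpow_nonneg (norm_nonneg _) _) (Real.rpow_nonneg (un _ _) _)) z)
    (hfC := fun z => by
      refine indicator_apply_le' (fun hz => ?_) fun _ => by positivity
      refine mul_le_mul ((le_abs_self _).trans ((hW _ (subset_closure hz.2)).trans (le_max_left _ _)))
        (Real.rpow_le_rpow (un _ _) (uC _ _) hq0.le) (Real.rpow_nonneg (un _ _) _) (le_max_right _ _))
    (hVM := by
      intro z hz
      rcases lt_or_ge T z.1 with c1 | c1
      · left
        rw [max_eq_right (by linarith)]; simp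
      right
      rcases lt_or_ge z.1 (τ / 2) with c2 | c2
      · have : 1 / 2 ≤ max (1 - z.1 / τ) 0 := by
          refine le_trans ?_ (le_max_left _ _)
          have : z.1 / τ ≤ 1 / 2 := by rw [div_le_iff₀ hτ]; linarith
          linarith
        have h3 := pow_le_pow_left₀ (by norm_num) this (k + 2)
        have h4 : D * (1 / 2) ^ (k + 2) = M + 1 := by
          rw [hD, mul_right_comm, ← mul_pow]; norm_num
        have h5 := mul_le_mul_of_nonneg_left h3 (by linarith : 0 ≤ D)
        have h6 := mul_nonneg (by linarith : 0 ≤ B) (hsum0 z)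
        unfold Vb
        linarith
      · have : ∃ i, 1 < |z.2 i - x0 i| := by
          by_contra hc
          push Not at hc
          exact hz ⟨⟨c2, c1⟩, hc⟩
        obtain ⟨i, hi⟩ := this
        have a1 : 1 ≤ (z.2 i - x0 i) ^ (2 * k + 4) := by
          rw [← Even.pow_abs (⟨k + 2, by ring⟩ : Even (2 * k + 4))]
          exact one_le_pow₀ hi.le
        have a2 := Finset.single_le_sum (f := fun i => (z.2 i - x0 i) ^ (2 * k + 4))
          (fun i _ => Even.pow_nonneg ⟨k + 2, by ring⟩ _) (Finset.mem_univ i)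
        have a3 : 1 ≤ ∑ i, (z.2 i - x0 i) ^ (2 * k + 4) := a1.trans a2
        have a4 := mul_le_mul_of_nonneg_left a3 (by linarith : 0 ≤ B)
        have a5 := hmx0 (1 - z.1 / τ)
        have a6 : 0 ≤ D * (max (1 - z.1 / τ) 0) ^ (k + 2) := by positivity
        unfold Vb
        linarith)
    (hVs := by
      intro z r hr
      unfold Vb
      rw [f1, f2]
      have := pow_le_pow_left₀ (hmx0 _) (hlip z r hr.1.le).1 (k + 2)
      have := mul_le_mul_of_nonneg_left this (by linarith : 0 ≤ D)
      linarith)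
    (hVb := by
      intro z r hr
      unfold Vb
      rw [f1, f2]
      obtain ⟨l1, l2⟩ := hlip z r hr.1.le
      have c := pow_conv (k + 1) (hmx0 _) l1
      have c2 := mul_le_mul_of_nonneg_left l2
        (by have := hmx0 (1 - (z.1 - r) / τ); positivity :
          0 ≤ ((k + 1 : ℕ) + 1 : ℝ) * (max (1 - (z.1 - r) / τ) 0) ^ (k + 1))
      have c3 := mul_le_mul_of_nonneg_left (c.trans c2) (by linarith : 0 ≤ D)
      have e : D * (((k + 1 : ℕ) + 1 : ℝ) * (max (1 - (z.1 - r) / τ) 0) ^ (k + 1) * (r / τ))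
        = r * (D * (k + 2) / τ * (max (1 - (z.1 - r) / τ) 0) ^ (k + 1)) := by
        push_cast; ring
      rw [e] at c3
      linarith)
    (hΘs := by
      intro z r hr
      have hr1 := hr.1
      have hr2 := hr.2
      rw [f3]
      rcases le_total (T - z.1) 1 with c | c
      · rw [max_eq_right (by linarith : T - 1 - z.1 ≤ 0), mul_zero]
        have := pow_le_pow_left₀ (hmx0 _) (max_le_max (by linarith : T - (z.1 + r) ≤ T - z.1) (le_refl (0:ℝ))) 2
        linarith
      · rw [max_eq_left (by linarith : 0 ≤ T - 1 - z.1), max_eq_left (by linarith : 0 ≤ T - z.1),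
          max_eq_left (by linarith : 0 ≤ T - (z.1 + r))]
        nlinarith)
    (hmain := by
      intro z hz hVU
      have hzQ := KQ z hz
      simp only [indicator_of_mem hzQ] at hVU ⊢
      rw [Finset.sum_congr rfl (fun i _ => p_fderiv k B (x0 i) z i)]
      have hx : L ≤ ‖z.2‖ ^ σ := by
        have n1 := norm_cube hz.2
        have n2 : ‖x0‖ ≤ ‖z.2‖ + ‖z.2 - x0‖ := by
          have := norm_sub_norm_le x0 z.2
          rw [norm_sub_rev] at this
          linarith
        have n3 : L ^ (1 / σ) ≤ ‖z.2‖ := by linarith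
        have n4 := Real.rpow_le_rpow (by positivity) n3 hσ0.le
        rwa [← Real.rpow_mul hL0, one_div, inv_mul_cancel₀ hσ0.ne', Real.rpow_one] at n4
      exact main_scalar (z := fun i => z.2 i - x0 i) hm hq0 hq1 hτ hk2 (un _ _) (hmx0 (1 - z.1 / τ))
        (by
          refine max_le ?_ zero_le_one
          have : 0 ≤ z.1 / τ := div_nonneg (by linarith [hz.1.1]) hτ.le
          linarith) hD1 hB1 hz.2 (le_max_left _ _) (le_max_right _ _) hx rfl hVU)
  filter_upwards [cmp] with z hz z1 z2 z3
  have hzQ : z ∈ Q := ⟨⟨by linarith, by linarith⟩, z3⟩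
  have := hz (lt_max_of_lt_left (by linarith))
  rw [indicator_of_mem hzQ] at this
  unfold Vb at this
  rw [max_eq_right (by rw [sub_nonpos, le_div_iff₀ hτ]; linarith)] at this
  simpa using this

end fin
end part8

/-- **Instantaneous shrinking and localization of supports (part of Theorem 2.1).**
For `N ≥ 1`, `m > 1`, `q ∈ (0,1)`, `σ > 0` and non-negative `u₀ ∈ L^∞(ℝᴺ)`, every
non-negative weak solution `u` of `∂ₜ u = Δ(uᵐ) − |x|^σ u^q` with `u(0) = u₀`
satisfies: for every `τ > 0` there is `R(τ) > 0` such that for a.e. `t ≥ τ`,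
`u(t,x) = 0` for a.e. `x` with `|x| ≥ R(τ)`. -/
theorem instantaneous_shrinking_localization
    (N : ℕ) (hN : 1 ≤ N) (m q σ : ℝ) (hm : 1 < m) (hq0 : 0 < q) (hq1 : q < 1)
    (hσ0 : 0 < σ)
    (u0 : EuclideanSpace ℝ (Fin N) → ℝ) (hu0 : IsBddNonneg N u0)
    (u : ℝ → EuclideanSpace ℝ (Fin N) → ℝ)
    (hu : IsWeakSolution N m q (fun x => ‖x‖ ^ σ) u0 u) :
    ∀ τ : ℝ, 0 < τ → ∃ R : ℝ, 0 < R ∧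
      ∀ᵐ t : ℝ, τ ≤ t → ∀ᵐ x : EuclideanSpace ℝ (Fin N), R ≤ ‖x‖ → u t x = 0 := by
  intro τ hτ
  obtain ⟨R0, hR0, B, hB, k, hk⟩ := barrier_bound hm hq0 hq1 hσ0 hu0 hu hτ
  refine ⟨R0 + 1, by linarith, ?_⟩
  have un := hu.2.1
  have hm0 : 0 < m := by linarith
  have all : ∀ᵐ z : ℝ × EuclideanSpace ℝ (Fin N), ∀ j n : ℕ,
      R0 ≤ ‖TopologicalSpace.denseSeq (EuclideanSpace ℝ (Fin N)) j‖ → τ ≤ z.1 → z.1 < ((n : ℝ) + 1) - 1 →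
        (∀ i, |z.2 i - TopologicalSpace.denseSeq (EuclideanSpace ℝ (Fin N)) j i| < 2) →
        u z.1 z.2 ^ m ≤ B * ∑ i, (z.2 i -
          TopologicalSpace.denseSeq (EuclideanSpace ℝ (Fin N)) j i) ^ (2 * k + 4) := by
    rw [ae_all_iff]; intro j
    rw [ae_all_iff]; intro n
    by_cases hj : R0 ≤ ‖TopologicalSpace.denseSeq (EuclideanSpace ℝ (Fin N)) j‖
    · filter_upwards [hk _ hj ((n : ℝ) + 1) (by positivity)] with z hz _
      exact hz
    · exact Filter.Eventually.of_forall fun z h => absurd h hj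
  have key : ∀ᵐ z : ℝ × EuclideanSpace ℝ (Fin N), τ ≤ z.1 → R0 + 1 ≤ ‖z.2‖ → u z.1 z.2 = 0 := by
    filter_upwards [all] with z hz z1 z2
    obtain ⟨n, hn⟩ := exists_nat_gt z.1
    have le : ∀ ε : ℝ, 0 < ε → ε ≤ 1 → u z.1 z.2 ^ m ≤ B * N * ε := by
      intro ε hε hε1
      obtain ⟨j, hj⟩ := (TopologicalSpace.denseRange_denseSeq (EuclideanSpace ℝ (Fin N))).exists_dist_lt
        z.2 hε
      set x0 := TopologicalSpace.denseSeq (EuclideanSpace ℝ (Fin N)) j with hx0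
      rw [dist_eq_norm] at hj
      have c : ∀ i, |z.2 i - x0 i| ≤ ε := fun i => (PiLp.norm_apply_le (z.2 - x0) i).trans hj.le
      have n1 : R0 ≤ ‖x0‖ := by
        have := norm_sub_norm_le z.2 x0
        linarith
      have h2 := hz j n n1 z1 (by linarith) (fun i => lt_of_le_of_lt (c i) (by linarith))
      refine h2.trans ?_
      rw [mul_assoc]
      refine mul_le_mul_of_nonneg_left ?_ hB
      calc ∑ i, (z.2 i - x0 i) ^ (2 * k + 4) ≤ ∑ i : Fin N, ε := Finset.sum_le_sum fun i _ => by
            rw [← Even.pow_abs (⟨k + 2, by ring⟩ : Even (2 * k + 4))]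
            refine le_trans ?_ (c i)
            exact pow_le_of_le_one (abs_nonneg _) ((c i).trans hε1) (by omega)
        _ = N * ε := by simp
    have h0 : u z.1 z.2 ^ m ≤ 0 := by
      have ht : Filter.Tendsto (fun ε : ℝ => B * N * ε) (nhdsWithin 0 (Ioi 0)) (nhds 0) := by
        have : Continuous (fun ε : ℝ => B * N * ε) := by fun_prop
        have := this.tendsto 0
        rw [mul_zero] at this
        exact this.mono_left nhdsWithin_le_nhds
      refine ge_of_tendsto ht ?_
      filter_upwards [Ioc_mem_nhdsGT (zero_lt_one (α := ℝ))] with ε hε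
      exact le ε hε.1 hε.2
    by_contra hc
    have : 0 < u z.1 z.2 := lt_of_le_of_ne (un _ _) (Ne.symm hc)
    have := Real.rpow_pos_of_pos this m
    linarith
  rw [Measure.volume_eq_prod] at key
  filter_upwards [Measure.ae_ae_of_ae_prod key] with t ht h1
  filter_upwards [ht] with x hx
  exact hx h1
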